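/- (L⁴ spacetime bound in three dimensions.) For n = 3 there exists a constant C > 0 such that every solution u as in the setup with λ > 0 satisfies ∫_ℝ ∫_{ℝ³} |u(t,x)|⁴ dx dt ≤ C ‖u₀‖³_{L²(ℝ³)} · sup_{t∈ℝ} ‖∇u(t,·)‖_{L²(ℝ³)}. -/

import Mathlib

open MeasureTheory Complex
open scoped FourierTransform

noncomputable section

/-- Euclidean space `ℝⁿ`. -/
abbrev En (n : ℕ) := EuclideanSpace ℝ (Fin n)

/-- Partial derivative `∂_{x_j} f` of a complex-valued function. -/
noncomputable def pd {n : ℕ} (j : Fin n) (f : En n → ℂ) (x : En n) : ℂ :=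
  fderiv ℝ f x (EuclideanSpace.single j 1)

/-- Laplacian `Δf` of a complex-valued function. -/
noncomputable def lap {n : ℕ} (f : En n → ℂ) (x : En n) : ℂ := ∑ j, pd j (pd j f) x

/-- Partial derivative `∂_{x_j} f` of a real-valued function. -/
noncomputable def rpd {n : ℕ} (j : Fin n) (f : En n → ℝ) (x : En n) : ℝ :=
  fderiv ℝ f x (EuclideanSpace.single j 1)

/-- Laplacian `Δf` of a real-valued function. -/
noncomputable def rlap {n : ℕ} (f : En n → ℝ) (x : En n) : ℝ := ∑ j, rpd j (rpd j f) x

/-- `u : ℝ × ℝⁿ → ℂ` is a smooth solution of the NLS `i∂ₜu + Δu = λ|u|^{p-1}u`,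
Schwartz class in `x` locally uniformly in `t`. -/
structure NLSSolution (n : ℕ) (p lam : ℝ) (u : ℝ → En n → ℂ) : Prop where
  smooth : ContDiff ℝ (⊤ : ℕ∞) (fun q : ℝ × En n => u q.1 q.2)
  decay : ∀ (k N : ℕ) (T : ℝ), ∃ C : ℝ, ∀ t : ℝ, |t| ≤ T → ∀ x : En n,
      ‖x‖ ^ N * ‖iteratedFDeriv ℝ k (u t) x‖ ≤ C
  eq : ∀ (t : ℝ) (x : En n),
      Complex.I * deriv (fun s => u s x) t + lap (u t) x
        = (lam : ℂ) * ((‖u t x‖ ^ (p - 1) : ℝ) : ℂ) * u t x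

/-- The momentum density `p_j = Im(ū ∂_{x_j} u)`. -/
noncomputable def mom {n : ℕ} (u : ℝ → En n → ℂ) (j : Fin n) (t : ℝ) (x : En n) : ℝ :=
  (starRingEnd ℂ (u t x) * pd j (u t) x).im

/-- The Morawetz action centered at `y`:
`M_y(t) = ∫ ((x-y)/|x-y|) · Im(ū ∇u)(t,x) dx`. -/
noncomputable def morAction {n : ℕ} (u : ℝ → En n → ℂ) (y : En n) (t : ℝ) : ℝ :=
  ∫ x : En n, ∑ j, ((x j - y j) / ‖x - y‖) * mom u j t x



/-- `F'` is the derivative of `F` in the direction `v`, everywhere. -/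
def HL {V : Type*} [NormedAddCommGroup V] [NormedSpace ℝ V] (v : V) (F F' : V → ℝ) : Prop :=
  ∀ q, HasLineDerivAt ℝ F (F' q) q v

section HLsec
variable {V : Type*} [NormedAddCommGroup V] [NormedSpace ℝ V] {v : V} {F F' G G' : V → ℝ}

theorem HL.add (h : HL v F F') (k : HL v G G') :
    HL v (fun q => F q + G q) (fun q => F' q + G' q) := by
  intro q
  have h1 := h q
  have h2 := k q
  unfold HasLineDerivAt at *
  exact h1.add h2

theorem HL.sub (h : HL v F F') (k : HL v G G') :
    HL v (fun q => F q - G q) (fun q => F' q - G' q) := by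
  intro q
  have h1 := h q
  have h2 := k q
  unfold HasLineDerivAt at *
  exact h1.sub h2

theorem HL.mul (h : HL v F F') (k : HL v G G') :
    HL v (fun q => F q * G q) (fun q => F' q * G q + F q * G' q) := by
  intro q
  have h1 := h q
  have h2 := k q
  unfold HasLineDerivAt at *
  have := h1.fun_mul h2
  simpa using this

theorem HL.neg (h : HL v F F') : HL v (fun q => - F q) (fun q => - F' q) := by
  intro q
  have h1 := h q
  unfold HasLineDerivAt at *
  exact h1.neg

theorem HL.const_mul (c : ℝ) (h : HL v F F') : HL v (fun q => c * F q) (fun q => c * F' q) := by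
  intro q
  have h1 := h q
  unfold HasLineDerivAt at *
  exact h1.const_mul c

theorem HL.sum {ι : Type*} (s : Finset ι) {f f' : ι → V → ℝ} (h : ∀ i, HL v (f i) (f' i)) :
    HL v (fun q => ∑ i ∈ s, f i q) (fun q => ∑ i ∈ s, f' i q) := by
  intro q
  have h1 := fun i => h i q
  unfold HasLineDerivAt at *
  exact HasDerivAt.fun_sum (fun i _ => h1 i)

theorem HL.congr (h : HL v F F') (e : ∀ q, F' q = G' q) : HL v F G' := by
  intro q; rw [← e q]; exact h q

theorem HL.comp (h : HL v F F') {φ φ' : ℝ → ℝ} (hφ : ∀ q, HasDerivAt φ (φ' (F q)) (F q)) :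
    HL v (fun q => φ (F q)) (fun q => φ' (F q) * F' q) := by
  intro q
  have h1 := h q
  have h2 := hφ q
  unfold HasLineDerivAt at *
  have h3 : HasDerivAt φ (φ' (F q)) (F (q + (0:ℝ) • v)) := by simpa using h2
  exact h3.comp (0:ℝ) h1

theorem HL.unique (h : HL v F F') (k : HL v F G') (q) : F' q = G' q := (h q).unique (k q)

theorem int_div [FiniteDimensional ℝ V] [MeasurableSpace V] [BorelSpace V] (μ : Measure V)
    [μ.IsAddHaarMeasure] (h : HL v F F') (hi : Integrable F μ) (hi' : Integrable F' μ) :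
    ∫ x, F' x ∂μ = 0 := by
  have := integral_bilinear_hasLineDerivAt_right_eq_neg_left_of_integrable (μ := μ)
    (f := fun _ : V => (1:ℝ)) (f' := fun _ => (0:ℝ)) (g := F) (g' := F') (v := v)
    (B := ContinuousLinearMap.mul ℝ ℝ) (by simp) (by simpa using hi') (by simpa using hi)
    (fun x _ => by
      unfold HasLineDerivAt
      exact hasDerivAt_const _ _) (fun x _ => h x)
  simpa using this

end HLsec

abbrev E3 := En 3
abbrev Q3 := ℝ × E3

instance haarEE : (volume : Measure (E3 × E3)).IsAddHaarMeasure :=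
  inferInstanceAs (((volume : Measure E3).prod (volume : Measure E3)).IsAddHaarMeasure)

/-- continuous and integrable -/
def Good (f : E3 → ℝ) : Prop := Continuous f ∧ Integrable f

/-- continuous and bounded -/
def BK (K : E3 → ℝ) : Prop := Continuous K ∧ ∃ C, ∀ z, |K z| ≤ C

/-- the interaction form -/
def form (K f g : E3 → ℝ) : ℝ := ∫ z : E3 × E3, f z.2 * K (z.1 - z.2) * g z.1

theorem form_int {K f g : E3 → ℝ} (hK : BK K) (hf : Good f) (hg : Good g) :
    Integrable (fun z : E3 × E3 => f z.2 * K (z.1 - z.2) * g z.1) := by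
  obtain ⟨hKc, C, hC⟩ := hK
  have h1 : Integrable (fun z : E3 × E3 => g z.1 * f z.2) := hg.2.mul_prod hf.2
  have h2 := h1.bdd_mul (c := C) (f := fun z : E3 × E3 => K (z.1 - z.2))
    (by
      apply Continuous.aestronglyMeasurable
      fun_prop) (Filter.Eventually.of_forall fun z => hC _)
  refine h2.congr (Filter.Eventually.of_forall fun z => ?_)
  simp only; ring

theorem form_symm {K : E3 → ℝ} (f g : E3 → ℝ) (hK : ∀ z, K (-z) = K z) :
    form K f g = form K g f := by
  unfold form
  have := MeasureTheory.integral_prod_swap (μ := (volume : Measure E3)) (ν := (volume : Measure E3))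
    (fun z : E3 × E3 => f z.2 * K (z.1 - z.2) * g z.1)
  refine Eq.trans this.symm ?_
  apply integral_congr_ae
  refine Filter.Eventually.of_forall fun z => ?_
  simp only [Prod.fst_swap, Prod.snd_swap]
  rw [← hK, neg_sub]; ring

theorem HL.fst {v : E3} {g g' : E3 → ℝ} (h : HL v g g') :
    HL ((v, 0) : E3 × E3) (fun z => g z.1) (fun z => g' z.1) := by
  intro z
  have := h z.1
  unfold HasLineDerivAt at *
  simpa using this

theorem HL.fst0 {v : E3} (g : E3 → ℝ) :
    HL ((v, 0) : E3 × E3) (fun z => g z.2) (fun _ => 0) := by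
  intro z
  unfold HasLineDerivAt at *
  simpa using hasDerivAt_const _ _

theorem HL.snd {v : E3} {g g' : E3 → ℝ} (h : HL v g g') :
    HL ((0, v) : E3 × E3) (fun z => g z.2) (fun z => g' z.2) := by
  intro z
  have := h z.2
  unfold HasLineDerivAt at *
  simpa using this

theorem HL.snd0 {v : E3} (g : E3 → ℝ) :
    HL ((0, v) : E3 × E3) (fun z => g z.1) (fun _ => 0) := by
  intro z
  unfold HasLineDerivAt at *
  simpa using hasDerivAt_const _ _

theorem HL.diffx {v : E3} {g g' : E3 → ℝ} (h : HL v g g') :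
    HL ((v, 0) : E3 × E3) (fun z => g (z.1 - z.2)) (fun z => g' (z.1 - z.2)) := by
  intro z
  have := h (z.1 - z.2)
  unfold HasLineDerivAt at *
  convert! this using 2 with s
  simp; abel_nf

theorem HL.diffy {v : E3} {g g' : E3 → ℝ} (h : HL v g g') :
    HL ((0, v) : E3 × E3) (fun z => g (z.1 - z.2)) (fun z => - g' (z.1 - z.2)) := by
  intro z
  have h1 := (h (z.1 - z.2)).smul (-1)
  unfold HasLineDerivAt at *
  convert! h1 using 2 with s
  · simp; abel_nf
  · simp

theorem form_ibp_x {v : E3} {K K' f g g' : E3 → ℝ} (hK : BK K) (hK' : BK K') (hf : Good f)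
    (hg : Good g) (hg' : Good g') (dK : HL v K K') (dg : HL v g g') :
    form K' f g = - form K f g' := by
  have h := ((HL.fst0 (v := v) f).mul dK.diffx).mul dg.fst
  have i1 := form_int hK' hf hg
  have i2 := form_int hK hf hg'
  have h3 := int_div volume (h.congr (G' := fun z => f z.2 * K' (z.1 - z.2) * g z.1
    + f z.2 * K (z.1 - z.2) * g' z.1) (fun z => by ring)) (form_int hK hf hg) (i1.add i2)
  rw [integral_add i1 i2] at h3
  unfold form; linarith

theorem form_ibp_y {v : E3} {K K' f f' g : E3 → ℝ} (hK : BK K) (hK' : BK K') (hf : Good f)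
    (hg : Good g) (hf' : Good f') (dK : HL v K K') (df : HL v f f') :
    form K' f g = form K f' g := by
  have h := (df.snd.mul dK.diffy).mul (HL.snd0 (v := v) g)
  have i1 := form_int hK' hf hg
  have i2 := form_int hK hf' hg
  have h3 := int_div volume (h.congr (G' := fun z => f' z.2 * K (z.1 - z.2) * g z.1
    - f z.2 * K' (z.1 - z.2) * g z.1) (fun z => by ring)) (form_int hK hf hg) (i2.sub i1)
  rw [integral_sub i2 i1] at h3
  unfold form; linarith

theorem form_sum_left {ι : Type*} (s : Finset ι) {K g : E3 → ℝ} {f : ι → E3 → ℝ} (hK : BK K)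
    (hf : ∀ i, Good (f i)) (hg : Good g) :
    form K (fun y => ∑ i ∈ s, f i y) g = ∑ i ∈ s, form K (f i) g := by
  unfold form
  rw [← integral_finsetSum _ (fun i _ => form_int hK (hf i) hg)]
  congr 1; ext z
  simp [Finset.sum_mul]

theorem form_sum_right {ι : Type*} (s : Finset ι) {K g : E3 → ℝ} {f : ι → E3 → ℝ} (hK : BK K)
    (hf : ∀ i, Good (f i)) (hg : Good g) :
    form K g (fun y => ∑ i ∈ s, f i y) = ∑ i ∈ s, form K g (f i) := by
  unfold form
  rw [← integral_finsetSum _ (fun i _ => form_int hK hg (hf i))]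
  congr 1; ext z
  simp [Finset.mul_sum]

theorem form_sum_mid {ι : Type*} (s : Finset ι) {f g : E3 → ℝ} {K : ι → E3 → ℝ}
    (hK : ∀ i, BK (K i)) (hf : Good f) (hg : Good g) :
    form (fun y => ∑ i ∈ s, K i y) f g = ∑ i ∈ s, form (K i) f g := by
  unfold form
  rw [← integral_finsetSum _ (fun i _ => form_int (hK i) hf hg)]
  congr 1; ext z
  simp [Finset.mul_sum, Finset.sum_mul]

theorem form_add_right {K f g h : E3 → ℝ} (hK : BK K) (hf : Good f) (hg : Good g) (hh : Good h) :
    form K f (fun x => g x + h x) = form K f g + form K f h := by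
  unfold form
  rw [← integral_add (form_int hK hf hg) (form_int hK hf hh)]
  congr 1; ext z; ring

theorem form_smul_right {K f g : E3 → ℝ} (c : ℝ) :
    form K f (fun x => c * g x) = c * form K f g := by
  unfold form
  rw [← integral_const_mul]
  congr 1; ext z; ring

theorem form_smul_left {K f g : E3 → ℝ} (c : ℝ) :
    form K (fun x => c * f x) g = c * form K f g := by
  unfold form
  rw [← integral_const_mul]
  congr 1; ext z; ring

theorem form_smul_mid {K f g : E3 → ℝ} (c : ℝ) :
    form (fun x => c * K x) f g = c * form K f g := by
  unfold form
  rw [← integral_const_mul]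
  congr 1; ext z; ring

theorem form_nonneg {K f g : E3 → ℝ} (hK : ∀ z, 0 ≤ K z) (hf : ∀ z, 0 ≤ f z) (hg : ∀ z, 0 ≤ g z) :
    0 ≤ form K f g :=
  integral_nonneg fun z => mul_nonneg (mul_nonneg (hf _) (hK _)) (hg _)

theorem form_abs_le {K f g : E3 → ℝ} {C : ℝ} (hKc : Continuous K) (hK : ∀ z, |K z| ≤ C)
    (hf : Good f) (hg : Good g) :
    |form K f g| ≤ C * ((∫ x, |f x|) * ∫ x, |g x|) := by
  have i := form_int ⟨hKc, C, hK⟩ hf hg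
  unfold form
  calc _ ≤ ∫ z : E3 × E3, |f z.2 * K (z.1 - z.2) * g z.1| := abs_integral_le_integral_abs
    _ ≤ ∫ z : E3 × E3, C * (|g z.1| * |f z.2|) := by
        apply integral_mono i.abs ((hg.2.abs.mul_prod hf.2.abs).const_mul C)
        intro z
        simp only [abs_mul]
        nlinarith [hK (z.1 - z.2), mul_nonneg (abs_nonneg (f z.2)) (abs_nonneg (g z.1))]
    _ = _ := by
        rw [integral_const_mul]
        have := integral_prod_mul (μ := (volume : Measure E3)) (ν := (volume : Measure E3))
          (fun x => |g x|) (fun x => |f x|)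
        rw [mul_comm (∫ x, |f x|)]
        exact congrArg (C * ·) this


/-- basis vector -/
abbrev ee (j : Fin 3) : E3 := EuclideanSpace.single j (1:ℝ)
/-- Kronecker delta -/
def dl (j k : Fin 3) : ℝ := if j = k then 1 else 0
def kb (ε : ℝ) (z : E3) : ℝ := (Real.sqrt (ε ^ 2 + ‖z‖ ^ 2))⁻¹
def ka (ε : ℝ) (j : Fin 3) (z : E3) : ℝ := z j * kb ε z
def kaa (ε : ℝ) (j k : Fin 3) (z : E3) : ℝ := dl j k * kb ε z - z j * z k * kb ε z ^ 3
def kA (ε : ℝ) (z : E3) : ℝ := 2 * kb ε z + ε ^ 2 * kb ε z ^ 3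
def kA1 (ε : ℝ) (k : Fin 3) (z : E3) : ℝ := -(2 * (z k * kb ε z ^ 3) + 3 * ε ^ 2 * (z k * kb ε z ^ 5))
def kA2 (ε : ℝ) (k : Fin 3) (z : E3) : ℝ :=
  -2 * kb ε z ^ 3 + 6 * (z k) ^ 2 * kb ε z ^ 5 - 3 * ε ^ 2 * kb ε z ^ 5
    + 15 * ε ^ 2 * (z k) ^ 2 * kb ε z ^ 7

theorem normsq3 (z : E3) : ‖z‖ ^ 2 = ∑ i, z i * z i := by
  rw [EuclideanSpace.real_norm_sq_eq]; simp [sq]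

theorem HL_coord (j k : Fin 3) : HL (ee k) (fun z : E3 => z j) (fun _ => dl j k) := by
  intro q
  unfold HasLineDerivAt
  have : (fun t : ℝ => (q + t • ee k) j) = fun t : ℝ => q j + t * dl j k := by
    ext t; simp [dl, ee]
  rw [this]
  simpa using ((hasDerivAt_id (0:ℝ)).mul_const (dl j k)).const_add (q j)

theorem HL_normsq (k : Fin 3) : HL (ee k) (fun z : E3 => ‖z‖ ^ 2) (fun z => 2 * z k) := by
  have h := HL.sum Finset.univ (fun i => (HL_coord i k).mul (HL_coord i k))
  have h2 : (fun z : E3 => ‖z‖ ^ 2) = fun z => ∑ i, z i * z i := by ext z; exact normsq3 z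
  rw [h2]
  refine h.congr fun z => ?_
  fin_cases k <;> simp [Fin.sum_univ_three, dl] <;> ring


theorem kb_pos {ε : ℝ} (hε : 0 < ε) (z : E3) : 0 < kb ε z := by unfold kb; positivity

theorem kb_sq {ε : ℝ} (hε : 0 < ε) (z : E3) : kb ε z ^ 2 * (ε ^ 2 + ‖z‖ ^ 2) = 1 := by
  unfold kb
  rw [inv_pow, Real.sq_sqrt (by positivity)]
  exact inv_mul_cancel₀ (by positivity)

theorem kb_le {ε : ℝ} (hε : 0 < ε) (z : E3) : kb ε z ≤ ε⁻¹ := by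
  unfold kb
  apply inv_anti₀ hε
  apply Real.le_sqrt_of_sq_le
  nlinarith [sq_nonneg ‖z‖]

theorem kb_cont {ε : ℝ} (hε : 0 < ε) : Continuous (kb ε) := by
  unfold kb
  apply Continuous.inv₀ (by fun_prop)
  intro z; positivity

theorem HL_kb {ε : ℝ} (hε : 0 < ε) (k : Fin 3) : HL (ee k) (kb ε) (fun z => - z k * kb ε z ^ 3) := by
  have h := (HL_normsq k).comp (φ := fun s => (Real.sqrt (ε ^ 2 + s))⁻¹)
    (φ' := fun s => - (1 / (2 * Real.sqrt (ε ^ 2 + s))) / (Real.sqrt (ε ^ 2 + s)) ^ 2) (by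
      intro q
      have hp : 0 < ε ^ 2 + ‖q‖ ^ 2 := by positivity
      have h1 : HasDerivAt (fun s : ℝ => ε ^ 2 + s) 1 (‖q‖ ^ 2) := (hasDerivAt_id _).const_add _
      exact (h1.sqrt hp.ne').fun_inv (by positivity))
  refine HL.congr h fun z => ?_
  have hp : 0 < Real.sqrt (ε ^ 2 + ‖z‖ ^ 2) := by positivity
  unfold kb
  field_simp

theorem HL_kb_pow {ε : ℝ} (hε : 0 < ε) (k : Fin 3) (n : ℕ) :
    HL (ee k) (fun z => kb ε z ^ n) (fun z => - n * z k * kb ε z ^ (n + 2)) := by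
  have h := (HL_kb hε k).comp (φ := fun s => s ^ n) (φ' := fun s => n * s ^ (n - 1))
    (fun q => hasDerivAt_pow n _)
  refine HL.congr h fun z => ?_
  rcases n with _ | n
  · simp
  · simp only [Nat.add_sub_cancel]
    ring

theorem HL_ka {ε : ℝ} (hε : 0 < ε) (j k : Fin 3) : HL (ee k) (ka ε j) (kaa ε j k) :=
  ((HL_coord j k).mul (HL_kb hε k)).congr fun z => by unfold kaa; ring

theorem HL_kA {ε : ℝ} (hε : 0 < ε) (k : Fin 3) : HL (ee k) (kA ε) (kA1 ε k) :=
  (((HL_kb hε k).const_mul 2).add ((HL_kb_pow hε k 3).const_mul (ε ^ 2))).congr fun z => by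
    unfold kA1; push_cast; ring

theorem HL_kA1 {ε : ℝ} (hε : 0 < ε) (k : Fin 3) : HL (ee k) (kA1 ε k) (kA2 ε k) :=
  ((((HL_coord k k).mul (HL_kb_pow hε k 3)).const_mul 2).add
    (((HL_coord k k).mul (HL_kb_pow hε k 5)).const_mul (3 * ε ^ 2))).neg.congr fun z => by
    simp only [kA2, dl, if_true]; push_cast; ring

theorem sum_kaa {ε : ℝ} (hε : 0 < ε) (z : E3) : ∑ j, kaa ε j j z = kA ε z := by
  have h := kb_sq hε z
  rw [normsq3] at h
  simp only [kaa, kA, dl, Fin.sum_univ_three, if_true] at *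
  linear_combination (-kb ε z) * h

theorem sum_kA2 {ε : ℝ} (hε : 0 < ε) (z : E3) : ∑ j, kA2 ε j z = -(15 * ε ^ 4 * kb ε z ^ 7) := by
  have h := kb_sq hε z
  rw [normsq3] at h
  simp only [kA2, Fin.sum_univ_three] at *
  linear_combination (6 * kb ε z ^ 3 + 15 * ε ^ 2 * kb ε z ^ 5) * h

theorem coord_kb_le {ε : ℝ} (hε : 0 < ε) (j : Fin 3) (z : E3) : |z j * kb ε z| ≤ 1 := by
  have h := kb_sq hε z
  rw [← sq_le_one_iff_abs_le_one]
  have : z j * z j ≤ ‖z‖ ^ 2 := by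
    rw [normsq3]
    exact Finset.single_le_sum (f := fun i => z i * z i) (fun i _ => mul_self_nonneg _)
      (Finset.mem_univ j)
  nlinarith [mul_nonneg (sq_nonneg (kb ε z)) (sub_nonneg.2 this), sq_nonneg (kb ε z * ε)]


theorem BK.mul {K L : E3 → ℝ} (h : BK K) (k : BK L) : BK (fun z => K z * L z) := by
  obtain ⟨h1, C, hC⟩ := h
  obtain ⟨k1, D, hD⟩ := k
  refine ⟨h1.mul k1, C * D, fun z => ?_⟩
  rw [abs_mul]
  exact mul_le_mul (hC z) (hD z) (abs_nonneg _) ((abs_nonneg _).trans (hC z))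

theorem BK.add {K L : E3 → ℝ} (h : BK K) (k : BK L) : BK (fun z => K z + L z) := by
  obtain ⟨h1, C, hC⟩ := h
  obtain ⟨k1, D, hD⟩ := k
  exact ⟨h1.add k1, C + D, fun z => (abs_add_le _ _).trans (add_le_add (hC z) (hD z))⟩

theorem BK.const (c : ℝ) : BK (fun _ => c) := ⟨continuous_const, |c|, fun _ => le_rfl⟩

theorem BK.congr {K L : E3 → ℝ} (h : BK K) (k : ∀ z, K z = L z) : BK L := by
  have : K = L := funext k
  rwa [← this]

theorem BK.pow {K : E3 → ℝ} (h : BK K) (n : ℕ) : BK (fun z => K z ^ n) := by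
  induction n with
  | zero => simpa using BK.const 1
  | succ n ih => exact (ih.mul h).congr fun z => by ring

theorem BK_kb {ε : ℝ} (hε : 0 < ε) : BK (kb ε) :=
  ⟨kb_cont hε, ε⁻¹, fun z => by rw [abs_of_pos (kb_pos hε z)]; exact kb_le hε z⟩

theorem BK_ka {ε : ℝ} (hε : 0 < ε) (j : Fin 3) : BK (ka ε j) :=
  ⟨by unfold ka; exact Continuous.mul (by fun_prop) (kb_cont hε), 1, coord_kb_le hε j⟩

theorem BK_kaa {ε : ℝ} (hε : 0 < ε) (j k : Fin 3) : BK (kaa ε j k) :=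
  (((BK.const (dl j k)).mul (BK_kb hε)).add
    ((BK.const (-1)).mul (((BK_ka hε j).mul (BK_ka hε k)).mul (BK_kb hε)))).congr fun z => by
    unfold kaa ka; ring

theorem BK_kA {ε : ℝ} (hε : 0 < ε) : BK (kA ε) :=
  (((BK.const 2).mul (BK_kb hε)).add
    ((BK.const (ε ^ 2)).mul ((BK_kb hε).pow 3))).congr fun z => by
    unfold kA; ring

theorem BK_kA1 {ε : ℝ} (hε : 0 < ε) (k : Fin 3) : BK (kA1 ε k) :=
  (((BK.const (-2)).mul ((BK_ka hε k).mul ((BK_kb hε).pow 2))).add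
    ((BK.const (-3 * ε ^ 2)).mul ((BK_ka hε k).mul ((BK_kb hε).pow 4)))).congr fun z => by
    unfold kA1 ka; ring

theorem BK_kA2 {ε : ℝ} (hε : 0 < ε) (k : Fin 3) : BK (kA2 ε k) :=
  (((BK.const (-2)).mul ((BK_kb hε).pow 3)).add
    (((BK.const 6).mul (((BK_ka hε k).pow 2).mul ((BK_kb hε).pow 3))).add
    (((BK.const (-3 * ε ^ 2)).mul ((BK_kb hε).pow 5)).add
    ((BK.const (15 * ε ^ 2)).mul (((BK_ka hε k).pow 2).mul ((BK_kb hε).pow 5)))))).congr fun z => by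
    unfold kA2 ka; ring

theorem kA_nonneg {ε : ℝ} (hε : 0 < ε) (z : E3) : 0 ≤ kA ε z := by
  have := kb_pos hε z
  unfold kA; positivity

theorem kaa_psd {ε : ℝ} (hε : 0 < ε) (z : E3) (V : Fin 3 → ℝ) : 0 ≤ ∑ j, ∑ k, kaa ε j k z * (V j * V k) := by
  have hb := kb_pos hε z
  have h := kb_sq hε z
  have e : ∑ j, ∑ k, kaa ε j k z * (V j * V k)
      = kb ε z * ((∑ j, V j * V j) - kb ε z ^ 2 * (∑ j, z j * V j) ^ 2) := by
    simp [kaa, dl, Fin.sum_univ_three]; ring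
  rw [e]
  apply mul_nonneg hb.le
  have cs : (∑ j, z j * V j) ^ 2 ≤ (∑ j, z j * z j) * (∑ j, V j * V j) := by
    have := Finset.sum_mul_sq_le_sq_mul_sq Finset.univ (fun j => z j) V
    simpa [sq] using this
  rw [← normsq3] at cs
  have hV : 0 ≤ ∑ j, V j * V j := Finset.sum_nonneg fun j _ => mul_self_nonneg _
  have h2 : kb ε z ^ 2 * ‖z‖ ^ 2 ≤ 1 := by nlinarith [sq_nonneg (kb ε z * ε)]
  nlinarith [mul_le_mul_of_nonneg_left cs (sq_nonneg (kb ε z)), mul_le_mul_of_nonneg_right h2 hV]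


theorem kb_even (ε : ℝ) (z : E3) : kb ε (-z) = kb ε z := by simp [kb]
theorem kaa_even (ε : ℝ) (j k : Fin 3) (z : E3) : kaa ε j k (-z) = kaa ε j k z := by
  simp [kaa, kb_even]

/-- pointwise positivity of the two-body quadratic form -/
theorem twobody {ε : ℝ} (hε : 0 < ε) (z : E3) (a b a' b' : ℝ) (A B A' B' : Fin 3 → ℝ) :
    0 ≤ ∑ j, ∑ k, kaa ε j k z * ((a' ^ 2 + b' ^ 2) * (A j * A k + B j * B k)
      + (A' j * A' k + B' j * B' k) * (a ^ 2 + b ^ 2)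
      - 2 * ((a' * B' k - b' * A' k) * (a * B j - b * A j))) := by
  have h1 := kaa_psd hε z (fun j => A j * a' + B j * b' + a * A' j + b * B' j)
  have h2 := kaa_psd hε z (fun j => B j * a' - A j * b' + b * A' j - a * B' j)
  have h3 := kaa_psd hε z (fun j => A j * a' - B j * b' - (a * A' j - b * B' j))
  have h4 := kaa_psd hε z (fun j => A j * b' + B j * a' - a * B' j - b * A' j)
  have hs : ∀ j k, kaa ε j k z = kaa ε k j z := by
    intro j k
    have : dl j k = dl k j := by unfold dl; simp [eq_comm]
    unfold kaa; rw [this]; ring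
  simp only [Fin.sum_univ_three, hs 1 0, hs 2 0, hs 2 1] at *
  linarith


/-- weight -/
def Wt (x : E3) : ℝ := (1 + ‖x‖) ^ (-(4:ℝ))

theorem Wt_pos (x : E3) : 0 < Wt x := by unfold Wt; positivity
theorem Wt_le (x : E3) : Wt x ≤ 1 := by
  unfold Wt
  apply Real.rpow_le_one_of_one_le_of_nonpos
  · linarith [norm_nonneg x]
  · norm_num
theorem Wt_int : Integrable Wt := integrable_one_add_norm (by simp; norm_num)

/-- decaying in `x`, locally uniformly in time -/
def Dec (F : Q3 → ℝ) : Prop :=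
  ∀ T : ℝ, ∃ C : ℝ, 0 ≤ C ∧ ∀ t, |t| ≤ T → ∀ x, |F (t, x)| ≤ C * Wt x

/-- bounded locally uniformly in time -/
def LB (F : Q3 → ℝ) : Prop :=
  ∀ T : ℝ, ∃ C : ℝ, 0 ≤ C ∧ ∀ t, |t| ≤ T → ∀ x, |F (t, x)| ≤ C

theorem Dec.lb {F : Q3 → ℝ} (h : Dec F) : LB F := by
  intro T
  obtain ⟨C, h0, hC⟩ := h T
  exact ⟨C, h0, fun t ht x => (hC t ht x).trans (by nlinarith [Wt_le x])⟩

theorem LB.mul_dec {F G : Q3 → ℝ} (h : LB F) (k : Dec G) : Dec (fun q => F q * G q) := by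
  intro T
  obtain ⟨C, h0, hC⟩ := h T
  obtain ⟨D, k0, hD⟩ := k T
  refine ⟨C * D, by positivity, fun t ht x => ?_⟩
  rw [abs_mul, mul_assoc]
  exact mul_le_mul (hC t ht x) (hD t ht x) (abs_nonneg _) h0

theorem Dec.mul {F G : Q3 → ℝ} (h : Dec F) (k : Dec G) : Dec (fun q => F q * G q) := h.lb.mul_dec k

theorem Dec.add {F G : Q3 → ℝ} (h : Dec F) (k : Dec G) : Dec (fun q => F q + G q) := by
  intro T
  obtain ⟨C, h0, hC⟩ := h T
  obtain ⟨D, k0, hD⟩ := k T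
  refine ⟨C + D, by positivity, fun t ht x => ?_⟩
  rw [add_mul]
  exact (abs_add_le _ _).trans (add_le_add (hC t ht x) (hD t ht x))

theorem LB.const (c : ℝ) : LB (fun _ => c) := fun _ => ⟨|c|, abs_nonneg _, fun _ _ _ => le_rfl⟩

theorem Dec.zero : Dec (fun _ => 0) :=
  fun _ => ⟨0, le_rfl, fun _ _ x => by simp⟩

/-- continuous and decaying -/
def CD (F : Q3 → ℝ) : Prop := Continuous F ∧ Dec F

theorem CD.mul {F G : Q3 → ℝ} (h : CD F) (k : CD G) : CD (fun q => F q * G q) :=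
  ⟨h.1.mul k.1, h.2.mul k.2⟩
theorem CD.add {F G : Q3 → ℝ} (h : CD F) (k : CD G) : CD (fun q => F q + G q) :=
  ⟨h.1.add k.1, h.2.add k.2⟩
theorem CD.const_mul {F : Q3 → ℝ} (c : ℝ) (h : CD F) : CD (fun q => c * F q) :=
  ⟨continuous_const.mul h.1, (LB.const c).mul_dec h.2⟩
theorem CD.neg {F : Q3 → ℝ} (h : CD F) : CD (fun q => - F q) := by
  simpa using h.const_mul (-1)
theorem CD.sub {F G : Q3 → ℝ} (h : CD F) (k : CD G) : CD (fun q => F q - G q) := by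
  simpa [sub_eq_add_neg] using h.add k.neg
theorem CD.zero : CD (fun _ => 0) := ⟨continuous_const, Dec.zero⟩
theorem CD.sum {ι : Type*} (s : Finset ι) {f : ι → Q3 → ℝ} (h : ∀ i, CD (f i)) :
    CD (fun q => ∑ i ∈ s, f i q) := by
  classical
  induction s using Finset.induction_on with
  | empty => simpa using CD.zero
  | insert a s ha ih =>
    simp only [Finset.sum_insert ha]
    exact (h a).add ih
theorem CD.congr {F G : Q3 → ℝ} (h : CD F) (e : ∀ q, F q = G q) : CD G := by
  have : F = G := funext e
  rwa [← this]

/-- time slice -/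
def sl (F : Q3 → ℝ) (t : ℝ) : E3 → ℝ := fun x => F (t, x)

theorem CD.good {F : Q3 → ℝ} (h : CD F) (t : ℝ) : Good (sl F t) := by
  obtain ⟨hc, hd⟩ := h
  have hc' : Continuous (sl F t) := by unfold sl; fun_prop
  refine ⟨hc', ?_⟩
  obtain ⟨C, _, hC⟩ := hd |t|
  exact (Wt_int.const_mul C).mono' hc'.aestronglyMeasurable
    (Filter.Eventually.of_forall fun x => hC t le_rfl x)

/-- time direction -/
abbrev et : Q3 := (1, 0)
/-- space direction -/
abbrev ex (j : Fin 3) : Q3 := (0, ee j)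

theorem HL.slice {F F' : Q3 → ℝ} {j : Fin 3} (h : HL (ex j) F F') (t : ℝ) :
    HL (ee j) (sl F t) (sl F' t) := by
  intro x
  have := h (t, x)
  unfold HasLineDerivAt at *
  simpa [sl] using this

theorem HL.time {F F' : Q3 → ℝ} (h : HL et F F') (t : ℝ) (x : E3) :
    HasDerivAt (fun s => F (s, x)) (F' (t, x)) t := by
  have h1 := h (t, x)
  unfold HasLineDerivAt at h1
  have h2 : HasDerivAt (fun s : ℝ => s - t) 1 t := (hasDerivAt_id t).sub_const t
  have h3 : HasDerivAt (fun s : ℝ => F ((t, x) + s • et)) (F' (t, x)) (t - t) := by simpa using h1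
  have h4 := HasDerivAt.comp (h := fun s : ℝ => s - t) t h3 h2
  simpa [Function.comp_def] using h4

theorem leib1 {f ft : Q3 → ℝ} (hf : CD f) (hft : CD ft) (h : HL et f ft) (t : ℝ) :
    HasDerivAt (fun s => ∫ x, sl f s x) (∫ x, sl ft t x) t := by
  obtain ⟨C, _, hC⟩ := hft.2 (|t| + 1)
  refine (hasDerivAt_integral_of_dominated_loc_of_deriv_le (μ := (volume : Measure E3))
    (F := fun s x => sl f s x) (F' := fun s x => sl ft s x) (bound := fun x => C * Wt x)
    (Metric.ball_mem_nhds t one_pos) ?_ (hf.good t).2 (hft.good t).1.aestronglyMeasurable ?_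
    (Wt_int.const_mul C) ?_).2
  · exact Filter.Eventually.of_forall fun s => (hf.good s).1.aestronglyMeasurable
  · refine Filter.Eventually.of_forall fun x s hs => hC s ?_ x
    rw [Metric.mem_ball, Real.dist_eq] at hs
    have := abs_sub_abs_le_abs_sub s t
    linarith
  · exact Filter.Eventually.of_forall fun x s _ => h.time s x

theorem leib2 {K : E3 → ℝ} {f ft g gt : Q3 → ℝ} (hK : BK K) (hf : CD f) (hft : CD ft)
    (h : HL et f ft) (hg : CD g) (hgt : CD gt) (k : HL et g gt) (t : ℝ) :
    HasDerivAt (fun s => form K (sl f s) (sl g s))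
      (form K (sl ft t) (sl g t) + form K (sl f t) (sl gt t)) t := by
  obtain ⟨C1, c1, hC1⟩ := hft.2 (|t| + 1)
  obtain ⟨C2, c2, hC2⟩ := hg.2 (|t| + 1)
  obtain ⟨C3, c3, hC3⟩ := hf.2 (|t| + 1)
  obtain ⟨C4, c4, hC4⟩ := hgt.2 (|t| + 1)
  obtain ⟨D, hD⟩ := hK.2
  have i1 := form_int hK (hft.good t) (hg.good t)
  have i2 := form_int hK (hf.good t) (hgt.good t)
  have key := (hasDerivAt_integral_of_dominated_loc_of_deriv_le (μ := (volume : Measure (E3 × E3)))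
    (F := fun s z => sl f s z.2 * K (z.1 - z.2) * sl g s z.1)
    (F' := fun s z => sl ft s z.2 * K (z.1 - z.2) * sl g s z.1
      + sl f s z.2 * K (z.1 - z.2) * sl gt s z.1)
    (bound := fun z => (D * (C1 * C2 + C3 * C4)) * (Wt z.1 * Wt z.2))
    (Metric.ball_mem_nhds t one_pos) ?_ (form_int hK (hf.good t) (hg.good t))
    (i1.add i2).aestronglyMeasurable ?_
    ((Wt_int.mul_prod Wt_int).const_mul _) ?_).2
  · rw [integral_add i1 i2] at key
    exact key
  · exact Filter.Eventually.of_forall fun s =>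
      (form_int hK (hf.good s) (hg.good s)).aestronglyMeasurable
  · refine Filter.Eventually.of_forall fun z s hs => ?_
    have hs' : |s| ≤ |t| + 1 := by
      rw [Metric.mem_ball, Real.dist_eq] at hs
      have := abs_sub_abs_le_abs_sub s t
      linarith
    have hD0 : 0 ≤ D := (abs_nonneg _).trans (hD 0)
    have b1 : |sl ft s z.2 * K (z.1 - z.2) * sl g s z.1|
        ≤ (C1 * Wt z.2) * D * (C2 * Wt z.1) := by
      rw [abs_mul, abs_mul]
      have := Wt_pos z.2
      gcongr
      · exact hC1 s hs' _
      · exact hD _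
      · exact hC2 s hs' _
    have b2 : |sl f s z.2 * K (z.1 - z.2) * sl gt s z.1|
        ≤ (C3 * Wt z.2) * D * (C4 * Wt z.1) := by
      rw [abs_mul, abs_mul]
      have := Wt_pos z.2
      gcongr
      · exact hC3 s hs' _
      · exact hD _
      · exact hC4 s hs' _
    rw [Real.norm_eq_abs]
    refine (abs_add_le _ _).trans ((add_le_add b1 b2).trans (le_of_eq ?_))
    ring
  · refine Filter.Eventually.of_forall fun z s _ => ?_
    exact ((h.time s z.2).mul_const _).fun_mul (k.time s z.1)

/-- space integral of a spatial derivative vanishes -/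
theorem int_div_sl {F F' : Q3 → ℝ} {j : Fin 3} (hF : CD F) (hF' : CD F') (h : HL (ex j) F F')
    (t : ℝ) : ∫ x, sl F' t x = 0 :=
  int_div volume (h.slice t) (hF.good t).2 (hF'.good t).2

/-! ### smooth functions -/

/-- directional derivative on space-time -/
def dd (v : Q3) (F : Q3 → ℝ) (q : Q3) : ℝ := fderiv ℝ F q v

theorem dd_smooth {F : Q3 → ℝ} (h : ContDiff ℝ (⊤ : ℕ∞) F) (v : Q3) :
    ContDiff ℝ (⊤ : ℕ∞) (dd v F) := by
  unfold dd
  exact (h.fderiv_right (m := (⊤ : ℕ∞)) (by norm_cast)).clm_apply contDiff_const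

theorem HL_dd {F : Q3 → ℝ} (h : ContDiff ℝ (⊤ : ℕ∞) F) (v : Q3) : HL v F (dd v F) := fun q =>
  ((h.differentiable (by simp)) q).hasFDerivAt.hasLineDerivAt v

theorem dd_comm {F : Q3 → ℝ} (h : ContDiff ℝ (⊤ : ℕ∞) F) (v w : Q3) (q : Q3) :
    dd v (dd w F) q = dd w (dd v F) q := by
  have hs : IsSymmSndFDerivAt ℝ F q :=
    (h.contDiffAt).isSymmSndFDerivAt (by
      rw [minSmoothness_of_isRCLikeNormedField]
      exact WithTop.coe_le_coe.2 (le_top : (2 : ℕ∞) ≤ ⊤))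
  have hd : Differentiable ℝ (fderiv ℝ F) :=
    (h.fderiv_right (m := (⊤ : ℕ∞)) (by norm_cast)).differentiable (by simp)
  have e : ∀ a b : Q3, dd a (dd b F) q = fderiv ℝ (fderiv ℝ F) q a b := by
    intro a b
    unfold dd
    rw [fderiv_clm_apply (hd q) (by fun_prop)]
    simp
  rw [e, e]
  exact hs v w

/-- all spatial derivatives decay -/
def SDec (F : Q3 → ℝ) : Prop := ∀ (k : ℕ) (T : ℝ), ∃ C : ℝ, 0 ≤ C ∧ ∀ t, |t| ≤ T → ∀ x,
  ‖iteratedFDeriv ℝ k (sl F t) x‖ ≤ C * Wt x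

/-- smooth with decaying spatial derivatives -/
def Nice (F : Q3 → ℝ) : Prop := ContDiff ℝ (⊤ : ℕ∞) F ∧ SDec F

theorem Nice.cd {F : Q3 → ℝ} (h : Nice F) : CD F := by
  refine ⟨h.1.continuous, fun T => ?_⟩
  obtain ⟨C, c0, hC⟩ := h.2 0 T
  exact ⟨C, c0, fun t ht x => by simpa [sl] using hC t ht x⟩

theorem sl_smooth {F : Q3 → ℝ} (h : ContDiff ℝ (⊤ : ℕ∞) F) (t : ℝ) :
    ContDiff ℝ (⊤ : ℕ∞) (sl F t) := by
  unfold sl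
  exact h.comp (contDiff_const.prodMk contDiff_id)

theorem sl_dd {F : Q3 → ℝ} (h : ContDiff ℝ (⊤ : ℕ∞) F) (t : ℝ) (j : Fin 3) (x : E3) :
    sl (dd (ex j) F) t x = fderiv ℝ (sl F t) x (ee j) := by
  have h1 := (HL_dd h (ex j)).slice t x
  have h2 := (((sl_smooth h t).differentiable (by simp)) x).hasFDerivAt.hasLineDerivAt (ee j)
  exact h1.unique h2

theorem Nice.dd {F : Q3 → ℝ} (h : Nice F) (j : Fin 3) : Nice (dd (ex j) F) := by
  refine ⟨dd_smooth h.1 _, fun k T => ?_⟩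
  obtain ⟨C, c0, hC⟩ := h.2 (k + 1) T
  set L : (E3 →L[ℝ] ℝ) →L[ℝ] ℝ := ContinuousLinearMap.apply ℝ ℝ (ee j) with hL
  refine ⟨‖L‖ * C, by positivity, fun t ht x => ?_⟩
  have e : sl (_root_.dd (ex j) F) t = L ∘ fderiv ℝ (sl F t) := by
    ext x; rw [sl_dd h.1]; simp [hL]
  rw [e]
  have sm : ContDiff ℝ (⊤ : ℕ∞) (fderiv ℝ (sl F t)) :=
    (sl_smooth h.1 t).fderiv_right (by norm_cast)
  refine (L.norm_iteratedFDeriv_comp_left (n := k) sm.contDiffAt (by exact_mod_cast le_top)).trans ?_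
  rw [norm_iteratedFDeriv_fderiv, mul_assoc]
  gcongr
  exact hC t ht x


def rho (A B : Q3 → ℝ) (q : Q3) : ℝ := A q ^ 2 + B q ^ 2
def ff (p lam : ℝ) (A B : Q3 → ℝ) (q : Q3) : ℝ := lam * rho A B q ^ ((p - 1) / 2)
def d1 (j : Fin 3) (A : Q3 → ℝ) : Q3 → ℝ := dd (ex j) A
def Lap (A : Q3 → ℝ) (q : Q3) : ℝ := ∑ k, d1 k (d1 k A) q

/-- the real form of the equation -/
structure Sys (p lam : ℝ) (A B : Q3 → ℝ) : Prop where
  hp : 1 < p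
  hl : 0 < lam
  nA : Nice A
  nB : Nice B
  eqA : ∀ q, dd et A q = - Lap B q + ff p lam A B q * B q
  eqB : ∀ q, dd et B q = Lap A q - ff p lam A B q * A q

theorem Nice.d1 {F : Q3 → ℝ} (h : Nice F) (j : Fin 3) : Nice (d1 j F) := h.dd j
theorem Nice.hl {F : Q3 → ℝ} (h : Nice F) (j : Fin 3) : HL (ex j) F (_root_.d1 j F) := HL_dd h.1 _

/-- one-dimensional derivative bound for the nonlinearity -/
theorem nonlin_deriv {s lam : ℝ} (hs : 0 < s) (hl : 0 < lam) {α β : ℝ → ℝ} {a b d : ℝ}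
    (ha : HasDerivAt α a 0) (hb : HasDerivAt β b 0)
    (hd : HasDerivAt (fun t => lam * (α t ^ 2 + β t ^ 2) ^ s * α t) d 0) :
    |d| ≤ lam * (α 0 ^ 2 + β 0 ^ 2) ^ s * (|a| + 2 * s * (|a| + |b|)) := by
  rcases eq_or_ne (α 0 ^ 2 + β 0 ^ 2) 0 with h0 | h0
  · have hα : α 0 = 0 := by nlinarith [sq_nonneg (α 0), sq_nonneg (β 0)]
    have hF : Filter.Tendsto (fun t => lam * (α t ^ 2 + β t ^ 2) ^ s) (nhdsWithin 0 {0}ᶜ)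
        (nhds 0) := by
      have : ContinuousAt (fun t => lam * (α t ^ 2 + β t ^ 2) ^ s) 0 := by
        apply ContinuousAt.mul continuousAt_const
        apply ContinuousAt.rpow_const _ (Or.inr hs.le)
        exact (ha.continuousAt.pow 2).add (hb.continuousAt.pow 2)
      have h2 := this.tendsto
      rw [h0, Real.zero_rpow hs.ne', mul_zero] at h2
      exact h2.mono_left nhdsWithin_le_nhds
    have hsl := hasDerivAt_iff_tendsto_slope.1 ha
    have hm := hF.mul hsl
    have hg : HasDerivAt (fun t => lam * (α t ^ 2 + β t ^ 2) ^ s * α t) (0 * a) 0 := by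
      rw [hasDerivAt_iff_tendsto_slope]
      refine hm.congr fun t => ?_
      simp only [slope, vsub_eq_sub, smul_eq_mul, hα]
      ring
    have : d = 0 := by simpa using hd.unique hg
    rw [this, h0, Real.zero_rpow hs.ne']; simp
  · have hpos : 0 < α 0 ^ 2 + β 0 ^ 2 := lt_of_le_of_ne (by positivity) (Ne.symm h0)
    have h1 := ((ha.fun_pow 2).fun_add (hb.fun_pow 2)).rpow_const (p := s) (Or.inl h0)
    have h2 := (h1.const_mul lam).fun_mul ha
    have e := hd.unique h2
    have hr : (α 0 ^ 2 + β 0 ^ 2) ^ s = (α 0 ^ 2 + β 0 ^ 2) ^ (s - 1) * (α 0 ^ 2 + β 0 ^ 2) := by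
      rw [← Real.rpow_add_one h0]; ring_nf
    set R := (α 0 ^ 2 + β 0 ^ 2) ^ (s - 1) with hR
    have hRp : 0 < R := Real.rpow_pos_of_pos hpos _
    have e2 : d = lam * R * ((α 0 ^ 2 + β 0 ^ 2) * a + 2 * s * (α 0 ^ 2 * a + α 0 * β 0 * b)) := by
      rw [e, hr]; push_cast; ring
    rw [e2, hr, abs_mul, abs_of_pos (by positivity : 0 < lam * R)]
    have k1 : |α 0 ^ 2 * a + α 0 * β 0 * b| ≤ (α 0 ^ 2 + β 0 ^ 2) * (|a| + |b|) := by
      refine (abs_add_le _ _).trans ?_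
      rw [abs_mul, abs_mul, abs_of_nonneg (sq_nonneg (α 0))]
      have : |α 0 * β 0| ≤ α 0 ^ 2 + β 0 ^ 2 := by
        rw [abs_le]; constructor <;> nlinarith [sq_nonneg (α 0 + β 0), sq_nonneg (α 0 - β 0)]
      nlinarith [abs_nonneg a, abs_nonneg b, sq_nonneg (β 0)]
    have k2 : |(α 0 ^ 2 + β 0 ^ 2) * a + 2 * s * (α 0 ^ 2 * a + α 0 * β 0 * b)|
        ≤ (α 0 ^ 2 + β 0 ^ 2) * |a| + 2 * s * ((α 0 ^ 2 + β 0 ^ 2) * (|a| + |b|)) := by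
      refine (abs_add_le _ _).trans ?_
      rw [abs_mul, abs_mul (2 * s), abs_of_pos hpos, abs_of_pos (by positivity : 0 < 2 * s)]
      gcongr
    calc _ ≤ lam * R * ((α 0 ^ 2 + β 0 ^ 2) * |a| + 2 * s * ((α 0 ^ 2 + β 0 ^ 2) * (|a| + |b|))) := by
          gcongr
      _ = _ := by ring

theorem dd_add {F G : Q3 → ℝ} (hF : ContDiff ℝ (⊤ : ℕ∞) F) (hG : ContDiff ℝ (⊤ : ℕ∞) G) (v q : Q3) :
    dd v (fun q => F q + G q) q = dd v F q + dd v G q :=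
  (HL_dd (hF.add hG) v).unique ((HL_dd hF v).add (HL_dd hG v)) q

namespace Sys
variable {p lam : ℝ} {A B : Q3 → ℝ}

theorem rho_nonneg (q : Q3) : 0 ≤ rho A B q := by unfold rho; positivity

theorem cd_rho (h : Sys p lam A B) : CD (rho A B) :=
  ((h.nA.cd.mul h.nA.cd).add (h.nB.cd.mul h.nB.cd)).congr fun q => by unfold rho; ring

theorem ff_cont (h : Sys p lam A B) : Continuous (ff p lam A B) := by
  unfold ff
  refine continuous_const.mul (h.cd_rho.1.rpow_const fun q => Or.inr ?_)
  linarith [h.hp]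

theorem ff_lb (h : Sys p lam A B) : LB (ff p lam A B) := by
  intro T
  obtain ⟨C, c0, hC⟩ := h.cd_rho.2.lb T
  have hl := h.hl
  refine ⟨lam * C ^ ((p - 1) / 2), by positivity, fun t ht x => ?_⟩
  unfold ff
  rw [abs_mul, abs_of_pos hl, abs_of_nonneg (Real.rpow_nonneg (rho_nonneg _) _)]
  gcongr
  · exact rho_nonneg _
  · linarith [h.hp]
  · exact (le_abs_self _).trans (hC t ht x)

theorem ff_nonneg (h : Sys p lam A B) (q : Q3) : 0 ≤ ff p lam A B q :=
  mul_nonneg h.hl.le (Real.rpow_nonneg (rho_nonneg _) _)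

theorem ff_mul (h : Sys p lam A B) {F : Q3 → ℝ} (hF : CD F) : CD (fun q => ff p lam A B q * F q) :=
  ⟨h.ff_cont.mul hF.1, h.ff_lb.mul_dec hF.2⟩

theorem lap_smooth {F : Q3 → ℝ} (hF : ContDiff ℝ (⊤ : ℕ∞) F) : ContDiff ℝ (⊤ : ℕ∞) (Lap F) := by
  unfold Lap
  exact ContDiff.sum fun k _ => dd_smooth (dd_smooth hF _) _

theorem lap_cd {F : Q3 → ℝ} (hF : Nice F) : CD (Lap F) :=
  CD.sum Finset.univ fun k => ((hF.d1 k).d1 k).cd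

theorem lap_hl {F : Q3 → ℝ} (hF : Nice F) (j : Fin 3) :
    HL (ex j) (Lap F) (fun q => ∑ k, d1 j (d1 k (d1 k F)) q) :=
  HL.sum Finset.univ fun k => ((hF.d1 k).d1 k).hl j

/-- nonlinear terms are smooth -/
theorem g1_smooth (h : Sys p lam A B) : ContDiff ℝ (⊤ : ℕ∞) (fun q => ff p lam A B q * A q) := by
  have : (fun q => ff p lam A B q * A q) = fun q => Lap A q - dd et B q := by
    ext q; rw [h.eqB q]; ring
  rw [this]
  exact (lap_smooth h.nA.1).sub (dd_smooth h.nB.1 _)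

theorem g2_smooth (h : Sys p lam A B) : ContDiff ℝ (⊤ : ℕ∞) (fun q => ff p lam A B q * B q) := by
  have : (fun q => ff p lam A B q * B q) = fun q => Lap B q + dd et A q := by
    ext q; rw [h.eqA q]; ring
  rw [this]
  exact (lap_smooth h.nB.1).add (dd_smooth h.nA.1 _)

def g1d (p lam : ℝ) (A B : Q3 → ℝ) (j : Fin 3) : Q3 → ℝ := d1 j (fun q => ff p lam A B q * A q)
def g2d (p lam : ℝ) (A B : Q3 → ℝ) (j : Fin 3) : Q3 → ℝ := d1 j (fun q => ff p lam A B q * B q)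

theorem g1d_bound (h : Sys p lam A B) (j : Fin 3) (q : Q3) : |g1d p lam A B j q|
    ≤ ff p lam A B q * (|d1 j A q| + 2 * ((p - 1) / 2) * (|d1 j A q| + |d1 j B q|)) := by
  have h1 := HL_dd h.g1_smooth (ex j) q
  have h2 := h.nA.hl j q
  have h3 := h.nB.hl j q
  unfold HasLineDerivAt at *
  have := nonlin_deriv (s := (p - 1) / 2) (by linarith [h.hp]) h.hl h2 h3 h1
  simpa [g1d, d1, ff, rho] using this

theorem g2d_bound (h : Sys p lam A B) (j : Fin 3) (q : Q3) : |g2d p lam A B j q|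
    ≤ ff p lam A B q * (|d1 j B q| + 2 * ((p - 1) / 2) * (|d1 j B q| + |d1 j A q|)) := by
  have h1 := HL_dd h.g2_smooth (ex j) q
  have h2 := h.nB.hl j q
  have h3 := h.nA.hl j q
  unfold HasLineDerivAt at *
  have := nonlin_deriv (s := (p - 1) / 2) (lam := lam) (d := dd (ex j) _ q)
    (by linarith [h.hp]) h.hl h2 h3
    (by convert! h1 using 5; simp [ff, rho, add_comm])
  simpa [g2d, d1, ff, rho, add_comm] using this

theorem abs_dec {F : Q3 → ℝ} (hF : Dec F) : Dec (fun q => |F q|) := by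
  intro T
  obtain ⟨C, c0, hC⟩ := hF T
  exact ⟨C, c0, fun t ht x => by simpa using hC t ht x⟩

theorem dec_mono {F G : Q3 → ℝ} (hF : Dec F) (hG : ∀ q, |G q| ≤ F q) : Dec G := by
  intro T
  obtain ⟨C, c0, hC⟩ := hF T
  exact ⟨C, c0, fun t ht x => (hG _).trans ((le_abs_self _).trans (hC t ht x))⟩

theorem g1d_cd (h : Sys p lam A B) (j : Fin 3) : CD (g1d p lam A B j) := by
  refine ⟨(dd_smooth h.g1_smooth _).continuous, dec_mono ?_ (h.g1d_bound j)⟩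
  have a := abs_dec (h.nA.d1 j).cd.2
  have b := abs_dec (h.nB.d1 j).cd.2
  exact h.ff_lb.mul_dec (a.add ((LB.const _).mul_dec (a.add b)))

theorem g2d_cd (h : Sys p lam A B) (j : Fin 3) : CD (g2d p lam A B j) := by
  refine ⟨(dd_smooth h.g2_smooth _).continuous, dec_mono ?_ (h.g2d_bound j)⟩
  have a := abs_dec (h.nA.d1 j).cd.2
  have b := abs_dec (h.nB.d1 j).cd.2
  exact h.ff_lb.mul_dec (b.add ((LB.const _).mul_dec (b.add a)))

/-- time derivative of `A`, and of its gradient -/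
theorem At_cd (h : Sys p lam A B) : CD (dd et A) :=
  ((lap_cd h.nB).neg.add (h.ff_mul h.nB.cd)).congr fun q => (h.eqA q).symm
theorem Bt_cd (h : Sys p lam A B) : CD (dd et B) :=
  ((lap_cd h.nA).sub (h.ff_mul h.nA.cd)).congr fun q => (h.eqB q).symm

theorem Atj (h : Sys p lam A B) (j : Fin 3) (q : Q3) : dd et (d1 j A) q
    = - (∑ k, d1 j (d1 k (d1 k B)) q) + g2d p lam A B j q := by
  unfold d1
  rw [dd_comm h.nA.1]
  have e : dd et A = fun q => - Lap B q + ff p lam A B q * B q := funext h.eqA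
  have h1 := HL_dd (dd_smooth h.nA.1 et) (ex j)
  have h2 := (lap_hl h.nB j).neg.add (HL_dd h.g2_smooth (ex j))
  rw [← e] at h2
  exact h1.unique h2 q

theorem Btj (h : Sys p lam A B) (j : Fin 3) (q : Q3) : dd et (d1 j B) q
    = (∑ k, d1 j (d1 k (d1 k A)) q) - g1d p lam A B j q := by
  unfold d1
  rw [dd_comm h.nB.1]
  have e : dd et B = fun q => Lap A q - ff p lam A B q * A q := funext h.eqB
  have h1 := HL_dd (dd_smooth h.nB.1 et) (ex j)
  have h2 := (lap_hl h.nA j).sub (HL_dd h.g1_smooth (ex j))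
  rw [← e] at h2
  exact h1.unique h2 q

theorem Atj_cd (h : Sys p lam A B) (j : Fin 3) : CD (dd et (d1 j A)) :=
  ((CD.sum Finset.univ fun k => (((h.nB.d1 k).d1 k).d1 j).cd).neg.add (h.g2d_cd j)).congr
    fun q => (h.Atj j q).symm
theorem Btj_cd (h : Sys p lam A B) (j : Fin 3) : CD (dd et (d1 j B)) :=
  ((CD.sum Finset.univ fun k => (((h.nA.d1 k).d1 k).d1 j).cd).sub (h.g1d_cd j)).congr
    fun q => (h.Btj j q).symm

/-- potential energy density -/
def HH (p : ℝ) (A B : Q3 → ℝ) (q : Q3) : ℝ := rho A B q ^ ((p + 1) / 2)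

theorem HL_rho (h : Sys p lam A B) (v : Q3) :
    HL v (rho A B) (fun q => 2 * (A q * dd v A q + B q * dd v B q)) := by
  have := ((HL_dd h.nA.1 v).mul (HL_dd h.nA.1 v)).add ((HL_dd h.nB.1 v).mul (HL_dd h.nB.1 v))
  have e : (fun q => A q * A q + B q * B q) = rho A B := by ext q; unfold rho; ring
  rw [e] at this
  exact this.congr fun q => by ring

theorem HL_HH (h : Sys p lam A B) (v : Q3) : HL v (fun q => lam / (p + 1) * HH p A B q)
    (fun q => ff p lam A B q * (A q * dd v A q + B q * dd v B q)) := by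
  have hp := h.hp
  have h1 := ((h.HL_rho v).comp (φ := fun s => s ^ ((p + 1) / 2))
    (φ' := fun s => (p + 1) / 2 * s ^ ((p + 1) / 2 - 1)) (fun q =>
      Real.hasDerivAt_rpow_const (Or.inr (by linarith)))).const_mul (lam / (p + 1))
  refine HL.congr h1 fun q => ?_
  unfold ff
  have : (p + 1) / 2 - 1 = (p - 1) / 2 := by ring
  rw [this]
  have : p + 1 ≠ 0 := by linarith
  field_simp

theorem HH_eq (h : Sys p lam A B) (q : Q3) : lam * HH p A B q = ff p lam A B q * rho A B q := by
  have hp := h.hp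
  unfold HH ff
  rcases eq_or_ne (rho A B q) 0 with h0 | h0
  · rw [h0, Real.zero_rpow (by linarith)]; ring
  · rw [mul_assoc, ← Real.rpow_add_one h0]; ring_nf

theorem HH_cd (h : Sys p lam A B) : CD (fun q => lam / (p + 1) * HH p A B q) := by
  have hp := h.hp
  refine ((h.ff_mul h.cd_rho).const_mul (1 / (p + 1))).congr fun q => ?_
  rw [← h.HH_eq]; ring

/-- the key nonlinear identity -/
theorem nl_id (h : Sys p lam A B) (j : Fin 3) (q : Q3) :
    A q * g1d p lam A B j q + B q * g2d p lam A B j q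
      = p * (ff p lam A B q * (A q * d1 j A q + B q * d1 j B q)) := by
  have hp := h.hp
  have h1 := (h.HL_HH (ex j)).const_mul (p + 1)
  have h2 := ((h.nA.hl j).mul (HL_dd h.g1_smooth (ex j))).add
    ((h.nB.hl j).mul (HL_dd h.g2_smooth (ex j)))
  have e : (fun q => (p + 1) * (lam / (p + 1) * HH p A B q)) =
      fun q => A q * (ff p lam A B q * A q) + B q * (ff p lam A B q * B q) := by
    ext q
    have h3 := h.HH_eq q
    have : p + 1 ≠ 0 := by linarith
    field_simp
    rw [h3]; rfl
  rw [e] at h1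
  have h3 := h2.unique h1 q
  simp only [g1d, g2d, d1] at *
  linear_combination h3

end Sys


def mo (A B : Q3 → ℝ) (j : Fin 3) (q : Q3) : ℝ := A q * d1 j B q - B q * d1 j A q
def moD (A B : Q3 → ℝ) (k : Fin 3) (q : Q3) : ℝ := A q * d1 k (d1 k B) q - B q * d1 k (d1 k A) q
def tens (A B : Q3 → ℝ) (j k : Fin 3) (q : Q3) : ℝ := d1 j A q * d1 k A q + d1 j B q * d1 k B q
def tD (A B : Q3 → ℝ) (j k : Fin 3) (q : Q3) : ℝ :=
  (d1 k (d1 j A) q * d1 k A q + d1 j A q * d1 k (d1 k A) q)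
    + (d1 k (d1 j B) q * d1 k B q + d1 j B q * d1 k (d1 k B) q)
def rr (A B : Q3 → ℝ) (k : Fin 3) (q : Q3) : ℝ := A q * d1 k A q + B q * d1 k B q
def rrd (A B : Q3 → ℝ) (k : Fin 3) (q : Q3) : ℝ :=
  (d1 k A q * d1 k A q + A q * d1 k (d1 k A) q) + (d1 k B q * d1 k B q + B q * d1 k (d1 k B) q)
def SS (A B : Q3 → ℝ) (q : Q3) : ℝ := ∑ k, rrd A B k q
def rrdd (A B : Q3 → ℝ) (j k : Fin 3) (q : Q3) : ℝ :=
  ((d1 j (d1 k A) q * d1 k A q + d1 k A q * d1 j (d1 k A) q)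
    + (d1 j A q * d1 k (d1 k A) q + A q * d1 j (d1 k (d1 k A)) q))
  + ((d1 j (d1 k B) q * d1 k B q + d1 k B q * d1 j (d1 k B) q)
    + (d1 j B q * d1 k (d1 k B) q + B q * d1 j (d1 k (d1 k B)) q))
def SSd (A B : Q3 → ℝ) (j : Fin 3) (q : Q3) : ℝ := ∑ k, rrdd A B j k q
def moT (p lam : ℝ) (A B : Q3 → ℝ) (j : Fin 3) (q : Q3) : ℝ :=
  (∑ k, (-2) * tD A B j k q) + (SSd A B j q + (-(p - 1)) * (ff p lam A B q * rr A B j q))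
def rhoT (A B : Q3 → ℝ) (q : Q3) : ℝ := ∑ k, (-2) * moD A B k q

namespace Sys
variable {p lam : ℝ} {A B : Q3 → ℝ}

theorem mo_cd (h : Sys p lam A B) (j : Fin 3) : CD (mo A B j) :=
  (h.nA.cd.mul (h.nB.d1 j).cd).sub (h.nB.cd.mul (h.nA.d1 j).cd)
theorem moD_cd (h : Sys p lam A B) (k : Fin 3) : CD (moD A B k) :=
  (h.nA.cd.mul ((h.nB.d1 k).d1 k).cd).sub (h.nB.cd.mul ((h.nA.d1 k).d1 k).cd)
theorem tens_cd (h : Sys p lam A B) (j k : Fin 3) : CD (tens A B j k) :=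
  ((h.nA.d1 j).cd.mul (h.nA.d1 k).cd).add ((h.nB.d1 j).cd.mul (h.nB.d1 k).cd)
theorem tD_cd (h : Sys p lam A B) (j k : Fin 3) : CD (tD A B j k) :=
  ((((h.nA.d1 j).d1 k).cd.mul (h.nA.d1 k).cd).add ((h.nA.d1 j).cd.mul ((h.nA.d1 k).d1 k).cd)).add
  ((((h.nB.d1 j).d1 k).cd.mul (h.nB.d1 k).cd).add ((h.nB.d1 j).cd.mul ((h.nB.d1 k).d1 k).cd))
theorem rr_cd (h : Sys p lam A B) (k : Fin 3) : CD (rr A B k) :=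
  (h.nA.cd.mul (h.nA.d1 k).cd).add (h.nB.cd.mul (h.nB.d1 k).cd)
theorem rrd_cd (h : Sys p lam A B) (k : Fin 3) : CD (rrd A B k) :=
  (((h.nA.d1 k).cd.mul (h.nA.d1 k).cd).add (h.nA.cd.mul ((h.nA.d1 k).d1 k).cd)).add
  (((h.nB.d1 k).cd.mul (h.nB.d1 k).cd).add (h.nB.cd.mul ((h.nB.d1 k).d1 k).cd))
theorem SS_cd (h : Sys p lam A B) : CD (SS A B) := CD.sum Finset.univ fun k => h.rrd_cd k
theorem rrdd_cd (h : Sys p lam A B) (j k : Fin 3) : CD (rrdd A B j k) :=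
  (((((h.nA.d1 k).d1 j).cd.mul (h.nA.d1 k).cd).add ((h.nA.d1 k).cd.mul ((h.nA.d1 k).d1 j).cd)).add
  (((h.nA.d1 j).cd.mul ((h.nA.d1 k).d1 k).cd).add (h.nA.cd.mul (((h.nA.d1 k).d1 k).d1 j).cd))).add
  (((((h.nB.d1 k).d1 j).cd.mul (h.nB.d1 k).cd).add ((h.nB.d1 k).cd.mul ((h.nB.d1 k).d1 j).cd)).add
  (((h.nB.d1 j).cd.mul ((h.nB.d1 k).d1 k).cd).add (h.nB.cd.mul (((h.nB.d1 k).d1 k).d1 j).cd)))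
theorem SSd_cd (h : Sys p lam A B) (j : Fin 3) : CD (SSd A B j) :=
  CD.sum Finset.univ fun k => h.rrdd_cd j k
theorem moT_cd (h : Sys p lam A B) (j : Fin 3) : CD (moT p lam A B j) :=
  (CD.sum Finset.univ fun k => (h.tD_cd j k).const_mul (-2)).add
    ((h.SSd_cd j).add ((h.ff_mul (h.rr_cd j)).const_mul _))
theorem rhoT_cd (h : Sys p lam A B) : CD (rhoT A B) :=
  CD.sum Finset.univ fun k => (h.moD_cd k).const_mul (-2)

theorem mo_hl (h : Sys p lam A B) (k : Fin 3) : HL (ex k) (mo A B k) (moD A B k) :=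
  ((h.nA.hl k).mul ((h.nB.d1 k).hl k)).sub ((h.nB.hl k).mul ((h.nA.d1 k).hl k)) |>.congr
    fun q => by unfold moD; ring
theorem tens_hl (h : Sys p lam A B) (j k : Fin 3) : HL (ex k) (tens A B j k) (tD A B j k) :=
  (((h.nA.d1 j).hl k).mul ((h.nA.d1 k).hl k)).add (((h.nB.d1 j).hl k).mul ((h.nB.d1 k).hl k))
theorem rr_hl (h : Sys p lam A B) (k : Fin 3) : HL (ex k) (rr A B k) (rrd A B k) :=
  ((h.nA.hl k).mul ((h.nA.d1 k).hl k)).add ((h.nB.hl k).mul ((h.nB.d1 k).hl k))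
theorem rrd_hl (h : Sys p lam A B) (j k : Fin 3) : HL (ex j) (rrd A B k) (rrdd A B j k) :=
  ((((h.nA.d1 k).hl j).mul ((h.nA.d1 k).hl j)).add ((h.nA.hl j).mul (((h.nA.d1 k).d1 k).hl j))).add
  ((((h.nB.d1 k).hl j).mul ((h.nB.d1 k).hl j)).add ((h.nB.hl j).mul (((h.nB.d1 k).d1 k).hl j)))
theorem SS_hl (h : Sys p lam A B) (j : Fin 3) : HL (ex j) (SS A B) (SSd A B j) :=
  HL.sum Finset.univ fun k => h.rrd_hl j k
theorem rho_hl (h : Sys p lam A B) (k : Fin 3) :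
    HL (ex k) (rho A B) (fun q => 2 * rr A B k q) := h.HL_rho (ex k)
theorem HH_hl (h : Sys p lam A B) (k : Fin 3) :
    HL (ex k) (fun q => lam / (p + 1) * HH p A B q) (fun q => ff p lam A B q * rr A B k q) :=
  h.HL_HH (ex k)

theorem rho_t (h : Sys p lam A B) : HL et (rho A B) (rhoT A B) := by
  refine (h.HL_rho et).congr fun q => ?_
  rw [h.eqA, h.eqB]
  unfold rhoT moD Lap
  simp only [Fin.sum_univ_three]
  ring

theorem mo_t (h : Sys p lam A B) (j : Fin 3) : HL et (mo A B j) (moT p lam A B j) := by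
  refine (((HL_dd h.nA.1 et).mul (HL_dd (h.nB.d1 j).1 et)).sub
    ((HL_dd h.nB.1 et).mul (HL_dd (h.nA.d1 j).1 et))).congr fun q => ?_
  rw [h.eqA, h.eqB, h.Atj, h.Btj]
  have h3 := h.nl_id j q
  have cA : ∀ k, d1 j (d1 k A) q = d1 k (d1 j A) q := fun k => dd_comm h.nA.1 _ _ _
  have cB : ∀ k, d1 j (d1 k B) q = d1 k (d1 j B) q := fun k => dd_comm h.nB.1 _ _ _
  unfold moT SSd rrdd tD rr Lap
  simp only [Fin.sum_univ_three, cA, cB]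
  linear_combination (-1) * h3

/-- mass conservation -/
theorem mass (h : Sys p lam A B) (t : ℝ) : ∫ x, sl (rho A B) t x = ∫ x, sl (rho A B) 0 x := by
  have h0 : ∀ t, ∫ x, sl (rhoT A B) t x = 0 := by
    intro t
    have e : ∀ x, sl (rhoT A B) t x = ∑ k, (-2) * sl (moD A B k) t x := fun x => rfl
    simp_rw [e]
    rw [integral_finsetSum _ fun k _ => ((h.moD_cd k).good t).2.const_mul _]
    refine Finset.sum_eq_zero fun k _ => ?_
    rw [integral_const_mul, int_div_sl (h.mo_cd k) (h.moD_cd k) (h.mo_hl k) t, mul_zero]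
  have h1 := leib1 h.cd_rho h.rhoT_cd h.rho_t
  exact is_const_of_deriv_eq_zero (fun s => (h1 s).differentiableAt)
    (fun s => (h1 s).deriv.trans (h0 s)) t 0

/-- gradient density -/
def gg (A B : Q3 → ℝ) (q : Q3) : ℝ := ∑ k, (d1 k A q ^ 2 + d1 k B q ^ 2)

def fl (A B : Q3 → ℝ) (k : Fin 3) (q : Q3) : ℝ := d1 k A q * dd et A q + d1 k B q * dd et B q
def flD (A B : Q3 → ℝ) (k : Fin 3) (q : Q3) : ℝ :=
  (d1 k (d1 k A) q * dd et A q + d1 k A q * dd et (d1 k A) q)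
   + (d1 k (d1 k B) q * dd et B q + d1 k B q * dd et (d1 k B) q)

theorem gg_cd (h : Sys p lam A B) : CD (gg A B) :=
  (CD.sum Finset.univ fun k => h.tens_cd k k).congr fun q => by
    unfold gg tens; simp only [pow_two]

theorem fl_cd (h : Sys p lam A B) (k : Fin 3) : CD (fl A B k) :=
  ((h.nA.d1 k).cd.mul h.At_cd).add ((h.nB.d1 k).cd.mul h.Bt_cd)
theorem flD_cd (h : Sys p lam A B) (k : Fin 3) : CD (flD A B k) :=
  ((((h.nA.d1 k).d1 k).cd.mul h.At_cd).add ((h.nA.d1 k).cd.mul (h.Atj_cd k))).add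
  ((((h.nB.d1 k).d1 k).cd.mul h.Bt_cd).add ((h.nB.d1 k).cd.mul (h.Btj_cd k)))
theorem fl_hl (h : Sys p lam A B) (k : Fin 3) : HL (ex k) (fl A B k) (flD A B k) :=
  ((((h.nA.d1 k).hl k).mul (HL_dd (dd_smooth h.nA.1 et) (ex k))).add
    (((h.nB.d1 k).hl k).mul (HL_dd (dd_smooth h.nB.1 et) (ex k)))).congr fun q => by
    unfold flD d1
    rw [dd_comm h.nA.1 (ex k) et, dd_comm h.nB.1 (ex k) et]

def en (p lam : ℝ) (A B : Q3 → ℝ) (q : Q3) : ℝ := (1 / 2) * gg A B q + lam / (p + 1) * HH p A B q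
theorem en_cd (h : Sys p lam A B) : CD (en p lam A B) := (h.gg_cd.const_mul _).add h.HH_cd
theorem en_t (h : Sys p lam A B) : HL et (en p lam A B) (fun q => ∑ k, flD A B k q) := by
  have h1 : HL et (gg A B) (fun q => ∑ k, ((dd et (d1 k A) q * d1 k A q + d1 k A q * dd et (d1 k A) q)
    + (dd et (d1 k B) q * d1 k B q + d1 k B q * dd et (d1 k B) q))) := by
    have := HL.sum Finset.univ (f := fun k q => d1 k A q * d1 k A q + d1 k B q * d1 k B q) fun k =>
      ((HL_dd (h.nA.d1 k).1 et).mul (HL_dd (h.nA.d1 k).1 et)).add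
        ((HL_dd (h.nB.d1 k).1 et).mul (HL_dd (h.nB.d1 k).1 et))
    have e : gg A B = fun q => ∑ k, (d1 k A q * d1 k A q + d1 k B q * d1 k B q) := by
      ext q; unfold gg; simp only [pow_two]
    rw [e]; exact this
  refine ((h1.const_mul (1 / 2)).add (h.HL_HH et)).congr fun q => ?_
  have e1 := h.eqA q
  have e2 := h.eqB q
  unfold Lap at e1 e2
  unfold flD
  simp only [Fin.sum_univ_three] at *
  linear_combination (dd et A q) * e2 - (dd et B q) * e1

theorem energy (h : Sys p lam A B) (t : ℝ) :
    ∫ x, sl (en p lam A B) t x = ∫ x, sl (en p lam A B) 0 x := by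
  have hc : CD (fun q => ∑ k, flD A B k q) := CD.sum Finset.univ fun k => h.flD_cd k
  have h0 : ∀ t, ∫ x, sl (fun q => ∑ k, flD A B k q) t x = 0 := by
    intro t
    have e : ∀ x, sl (fun q => ∑ k, flD A B k q) t x = ∑ k, sl (flD A B k) t x := fun x => rfl
    simp_rw [e]
    rw [integral_finsetSum _ fun k _ => ((h.flD_cd k).good t).2]
    exact Finset.sum_eq_zero fun k _ => int_div_sl (h.fl_cd k) (h.flD_cd k) (h.fl_hl k) t
  have h1 := leib1 h.en_cd hc h.en_t
  exact is_const_of_deriv_eq_zero (fun s => (h1 s).differentiableAt)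
    (fun s => (h1 s).deriv.trans (h0 s)) t 0

theorem grad_bd (h : Sys p lam A B) (t : ℝ) :
    ∫ x, sl (gg A B) t x ≤ 2 * ∫ x, sl (en p lam A B) 0 x := by
  rw [← h.energy t, ← integral_const_mul]
  refine integral_mono (h.gg_cd.good t).2 ((h.en_cd.good t).2.const_mul _) fun x => ?_
  have : 0 ≤ lam / (p + 1) * HH p A B (t, x) :=
    mul_nonneg (div_nonneg h.hl.le (by linarith [h.hp])) (Real.rpow_nonneg (rho_nonneg _) _)
  simp only [sl, en]
  linarith

theorem bdd (h : Sys p lam A B) :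
    BddAbove (Set.range fun t => Real.sqrt (∫ x, sl (gg A B) t x)) :=
  ⟨_, by rintro _ ⟨t, rfl⟩; exact Real.sqrt_le_sqrt (h.grad_bd t)⟩

end Sys


namespace Sys
variable {p lam : ℝ} {A B : Q3 → ℝ}

def Mor (ε : ℝ) (A B : Q3 → ℝ) (t : ℝ) : ℝ := ∑ j, form (ka ε j) (sl (rho A B) t) (sl (mo A B j) t)
def MorD (ε p lam : ℝ) (A B : Q3 → ℝ) (t : ℝ) : ℝ :=
  ∑ j, (form (ka ε j) (sl (rhoT A B) t) (sl (mo A B j) t)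
    + form (ka ε j) (sl (rho A B) t) (sl (moT p lam A B j) t))

theorem Mor_deriv (h : Sys p lam A B) {ε : ℝ} (hε : 0 < ε) (t : ℝ) :
    HasDerivAt (Mor ε A B) (MorD ε p lam A B t) t := by
  have := HasDerivAt.fun_sum (u := Finset.univ) fun j _ =>
    leib2 (BK_ka hε j) h.cd_rho h.rhoT_cd h.rho_t (h.mo_cd j) (h.moT_cd j) (h.mo_t j) t
  exact this

theorem term1 (h : Sys p lam A B) {ε : ℝ} (hε : 0 < ε) (t : ℝ) (j : Fin 3) :
    form (ka ε j) (sl (rhoT A B) t) (sl (mo A B j) t)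
      = ∑ k, (-2) * form (kaa ε j k) (sl (mo A B k) t) (sl (mo A B j) t) := by
  have e : sl (rhoT A B) t = fun x => ∑ k, sl (fun q => (-2) * moD A B k q) t x := rfl
  rw [e, form_sum_left Finset.univ (BK_ka hε j) (fun k => ((h.moD_cd k).const_mul (-2)).good t)
    ((h.mo_cd j).good t)]
  refine Finset.sum_congr rfl fun k _ => ?_
  rw [form_ibp_y (BK_ka hε j) (BK_kaa hε j k) ((h.mo_cd k).good t) ((h.mo_cd j).good t)
    ((h.moD_cd k).good t) (HL_ka hε j k) ((h.mo_hl k).slice t)]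
  exact form_smul_left (-2)

theorem term2 (h : Sys p lam A B) {ε : ℝ} (hε : 0 < ε) (t : ℝ) (j : Fin 3) :
    form (ka ε j) (sl (rho A B) t) (sl (moT p lam A B j) t)
      = (∑ k, 2 * form (kaa ε j k) (sl (rho A B) t) (sl (tens A B j k) t))
        - form (kaa ε j j) (sl (rho A B) t) (sl (SS A B) t)
        + (p - 1) * form (kaa ε j j) (sl (rho A B) t) (sl (fun q => lam / (p + 1) * HH p A B q) t) := by
  have gR := h.cd_rho.good t
  have gff := (h.ff_mul (h.rr_cd j))
  have c1 := (CD.sum Finset.univ fun k => (h.tD_cd j k).const_mul (-2)).good t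
  have c2 := ((h.SSd_cd j).add (gff.const_mul (-(p-1)))).good t
  have s1 : form (ka ε j) (sl (rho A B) t) (sl (moT p lam A B j) t)
    = form (ka ε j) (sl (rho A B) t) (sl (fun q => ∑ k, (-2) * tD A B j k q) t)
    + form (ka ε j) (sl (rho A B) t)
      (sl (fun q => SSd A B j q + (-(p-1)) * (ff p lam A B q * rr A B j q)) t) :=
    form_add_right (BK_ka hε j) gR c1 c2
  have s2 : form (ka ε j) (sl (rho A B) t)
      (sl (fun q => SSd A B j q + (-(p-1)) * (ff p lam A B q * rr A B j q)) t)
    = form (ka ε j) (sl (rho A B) t) (sl (SSd A B j) t)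
    + form (ka ε j) (sl (rho A B) t) (sl (fun q => (-(p-1)) * (ff p lam A B q * rr A B j q)) t) :=
    form_add_right (BK_ka hε j) gR ((h.SSd_cd j).good t) ((gff.const_mul (-(p-1))).good t)
  have s3 : form (ka ε j) (sl (rho A B) t) (sl (fun q => ∑ k, (-2) * tD A B j k q) t)
    = ∑ k, form (ka ε j) (sl (rho A B) t) (sl (fun q => (-2) * tD A B j k q) t) :=
    form_sum_right Finset.univ (BK_ka hε j) (fun k => ((h.tD_cd j k).const_mul (-2)).good t) gR
  rw [s1, s2, s3]
  have i1 : ∀ k, form (ka ε j) (sl (rho A B) t) (sl (fun q => (-2) * tD A B j k q) t)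
      = 2 * form (kaa ε j k) (sl (rho A B) t) (sl (tens A B j k) t) := by
    intro k
    rw [form_ibp_x (BK_ka hε j) (BK_kaa hε j k) gR ((h.tens_cd j k).good t) ((h.tD_cd j k).good t)
      (HL_ka hε j k) ((h.tens_hl j k).slice t)]
    have := form_smul_right (K := ka ε j) (f := sl (rho A B) t) (g := sl (tD A B j k) t) (-2)
    rw [show sl (fun q => (-2) * tD A B j k q) t = fun x => (-2) * sl (tD A B j k) t x from rfl, this]
    ring
  have i2 := form_ibp_x (BK_ka hε j) (BK_kaa hε j j) gR (h.SS_cd.good t) ((h.SSd_cd j).good t)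
      (HL_ka hε j j) ((h.SS_hl j).slice t)
  have i3 := form_ibp_x (BK_ka hε j) (BK_kaa hε j j) gR (h.HH_cd.good t) (gff.good t)
      (HL_ka hε j j) ((h.HH_hl j).slice t)
  have i4 := form_smul_right (K := ka ε j) (f := sl (rho A B) t)
    (g := sl (fun q => ff p lam A B q * rr A B j q) t) (-(p-1))
  rw [show sl (fun q => (-(p-1)) * (ff p lam A B q * rr A B j q)) t
    = fun x => (-(p-1)) * sl (fun q => ff p lam A B q * rr A B j q) t x from rfl, i4]
  simp_rw [i1]
  rw [i2, i3]
  ring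

theorem sum_kaa_form (h : Sys p lam A B) {ε : ℝ} (hε : 0 < ε) (t : ℝ) {g : E3 → ℝ} (hg : Good g) :
    ∑ j, form (kaa ε j j) (sl (rho A B) t) g = form (kA ε) (sl (rho A B) t) g := by
  rw [← form_sum_mid Finset.univ (fun j => BK_kaa hε j j) (h.cd_rho.good t) hg]
  congr 1; ext z; exact sum_kaa hε z

theorem kA_SS (h : Sys p lam A B) {ε : ℝ} (hε : 0 < ε) (t : ℝ) :
    form (kA ε) (sl (rho A B) t) (sl (SS A B) t)
      = -(15 / 2 * ε ^ 4) * form (fun z => kb ε z ^ 7) (sl (rho A B) t) (sl (rho A B) t) := by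
  have gR := h.cd_rho.good t
  have e : sl (SS A B) t = fun x => ∑ k, sl (rrd A B k) t x := rfl
  rw [e, form_sum_right Finset.univ (BK_kA hε) (fun k => (h.rrd_cd k).good t) gR]
  have i1 : ∀ k, form (kA ε) (sl (rho A B) t) (sl (rrd A B k) t)
      = (1 / 2) * form (kA2 ε k) (sl (rho A B) t) (sl (rho A B) t) := by
    intro k
    have a := form_ibp_x (BK_kA hε) (BK_kA1 hε k) gR ((h.rr_cd k).good t) ((h.rrd_cd k).good t)
      (HL_kA hε k) ((h.rr_hl k).slice t)
    have b := form_ibp_x (BK_kA1 hε k) (BK_kA2 hε k) gR gR (((h.rr_cd k).const_mul 2).good t)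
      (HL_kA1 hε k) ((h.rho_hl k).slice t)
    have c := form_smul_right (K := kA1 ε k) (f := sl (rho A B) t) (g := sl (rr A B k) t) 2
    rw [b]
    change _ = 1 / 2 * - form _ _ (fun x => 2 * sl (rr A B k) t x)
    rw [c, a]; ring
  simp_rw [i1]
  rw [← Finset.mul_sum, ← form_sum_mid Finset.univ (fun k => BK_kA2 hε k) gR gR]
  have e2 : (fun z => ∑ k, kA2 ε k z) = fun z => (-(15 * ε ^ 4)) * kb ε z ^ 7 := by
    ext z; rw [sum_kA2 hε z]; ring
  rw [e2, form_smul_mid]; ring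

theorem quad_nonneg (h : Sys p lam A B) {ε : ℝ} (hε : 0 < ε) (t : ℝ) :
    0 ≤ ∑ j, ∑ k, (2 * form (kaa ε j k) (sl (rho A B) t) (sl (tens A B j k) t)
      + (-2) * form (kaa ε j k) (sl (mo A B k) t) (sl (mo A B j) t)) := by
  have gR := h.cd_rho.good t
  have e : ∀ j k, (2 * form (kaa ε j k) (sl (rho A B) t) (sl (tens A B j k) t)
      + (-2) * form (kaa ε j k) (sl (mo A B k) t) (sl (mo A B j) t))
      = ∫ z : E3 × E3, kaa ε j k (z.1 - z.2) * (rho A B (t, z.2) * tens A B j k (t, z.1)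
        + tens A B j k (t, z.2) * rho A B (t, z.1) - 2 * (mo A B k (t, z.2) * mo A B j (t, z.1))) := by
    intro j k
    have s := form_symm (sl (rho A B) t) (sl (tens A B j k) t) (kaa_even ε j k)
    have e1 : 2 * form (kaa ε j k) (sl (rho A B) t) (sl (tens A B j k) t)
      + (-2) * form (kaa ε j k) (sl (mo A B k) t) (sl (mo A B j) t)
      = (form (kaa ε j k) (sl (rho A B) t) (sl (tens A B j k) t)
        + form (kaa ε j k) (sl (tens A B j k) t) (sl (rho A B) t))
        + (-2) * form (kaa ε j k) (sl (mo A B k) t) (sl (mo A B j) t) := by rw [← s]; ring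
    have f1 := form_int (BK_kaa hε j k) gR ((h.tens_cd j k).good t)
    have f2 := form_int (BK_kaa hε j k) ((h.tens_cd j k).good t) gR
    have f3 := form_int (BK_kaa hε j k) ((h.mo_cd k).good t) ((h.mo_cd j).good t)
    rw [e1]
    unfold form
    have f12 : Integrable (fun z : E3 × E3 =>
      sl (rho A B) t z.2 * kaa ε j k (z.1 - z.2) * sl (tens A B j k) t z.1
      + sl (tens A B j k) t z.2 * kaa ε j k (z.1 - z.2) * sl (rho A B) t z.1) := f1.add f2
    rw [← integral_const_mul, ← integral_add f1 f2, ← integral_add f12 (f3.const_mul (-2))]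
    congr 1; ext z; simp only [sl]; ring
  have i : ∀ j k, Integrable (fun z : E3 × E3 => kaa ε j k (z.1 - z.2) *
      (rho A B (t, z.2) * tens A B j k (t, z.1)
        + tens A B j k (t, z.2) * rho A B (t, z.1) - 2 * (mo A B k (t, z.2) * mo A B j (t, z.1)))) := by
    intro j k
    have f1 := form_int (BK_kaa hε j k) gR ((h.tens_cd j k).good t)
    have f2 := form_int (BK_kaa hε j k) ((h.tens_cd j k).good t) gR
    have f3 := form_int (BK_kaa hε j k) ((h.mo_cd k).good t) ((h.mo_cd j).good t)
    refine ((f1.add f2).add (f3.const_mul (-2))).congr (Filter.Eventually.of_forall fun z => ?_)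
    simp only [sl, Pi.add_apply]; ring
  simp_rw [e]
  simp_rw [← integral_finsetSum _ (fun k _ => i _ k)]
  rw [← integral_finsetSum _ (fun j _ => integrable_finsetSum _ fun k _ => i j k)]
  refine integral_nonneg fun z => ?_
  have := twobody hε (z.1 - z.2) (A (t, z.1)) (B (t, z.1)) (A (t, z.2)) (B (t, z.2))
    (fun j => d1 j A (t, z.1)) (fun j => d1 j B (t, z.1))
    (fun j => d1 j A (t, z.2)) (fun j => d1 j B (t, z.2))
  exact this

theorem MorD_lower (h : Sys p lam A B) {ε : ℝ} (hε : 0 < ε) (t : ℝ) :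
    15 / 2 * ε ^ 4 * form (fun z => kb ε z ^ 7) (sl (rho A B) t) (sl (rho A B) t)
      ≤ MorD ε p lam A B t := by
  have h1 := h.quad_nonneg hε t
  have h2 := h.kA_SS hε t
  have h3 := h.sum_kaa_form hε t (h.SS_cd.good t)
  have h4 := h.sum_kaa_form hε t (h.HH_cd.good t)
  have h5 : 0 ≤ form (kA ε) (sl (rho A B) t) (sl (fun q => lam / (p + 1) * HH p A B q) t) :=
    form_nonneg (kA_nonneg hε) (fun _ => rho_nonneg _) fun x =>
      mul_nonneg (div_nonneg h.hl.le (by linarith [h.hp])) (Real.rpow_nonneg (rho_nonneg _) _)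
  have h6 : 0 ≤ (p - 1) * form (kA ε) (sl (rho A B) t) (sl (fun q => lam / (p + 1) * HH p A B q) t) :=
    mul_nonneg (by linarith [h.hp]) h5
  unfold MorD
  simp_rw [h.term1 hε t, h.term2 hε t]
  rw [← h4] at h6
  rw [← h3] at h2
  simp only [Finset.sum_add_distrib, Finset.sum_sub_distrib, Finset.mul_sum] at *
  linarith

theorem mo_le (h : Sys p lam A B) (t : ℝ) (j : Fin 3) :
    ∫ x, |sl (mo A B j) t x| ≤ Real.sqrt (∫ x, sl (rho A B) t x) * Real.sqrt (∫ x, sl (gg A B) t x) := by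
  set m := ∫ x, sl (rho A B) t x with hm
  set g := ∫ x, sl (gg A B) t x with hg
  have m0 : 0 ≤ m := integral_nonneg fun x => rho_nonneg _
  have gg0 : ∀ q, 0 ≤ gg A B q := fun q => Finset.sum_nonneg fun k _ => by positivity
  have g0 : 0 ≤ g := integral_nonneg fun x => gg0 _
  have pt : ∀ q, mo A B j q ^ 2 ≤ rho A B q * gg A B q := by
    intro q
    have : d1 j A q ^ 2 + d1 j B q ^ 2 ≤ gg A B q := by
      unfold gg
      exact Finset.single_le_sum (f := fun k => d1 k A q ^ 2 + d1 k B q ^ 2)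
        (fun k _ => by positivity) (Finset.mem_univ j)
    have r0 := rho_nonneg (A := A) (B := B) q
    calc mo A B j q ^ 2 ≤ rho A B q * (d1 j A q ^ 2 + d1 j B q ^ 2) := by
          unfold mo rho; nlinarith [sq_nonneg (A q * d1 j A q + B q * d1 j B q)]
      _ ≤ _ := mul_le_mul_of_nonneg_left this r0
  have key : ∀ s : ℝ, 0 < s → 2 * ∫ x, |sl (mo A B j) t x| ≤ s * m + s⁻¹ * g := by
    intro s hs
    rw [hm, hg, ← integral_const_mul, ← integral_const_mul, ← integral_const_mul,
      ← integral_add ((h.cd_rho.good t).2.const_mul _) ((h.gg_cd.good t).2.const_mul _)]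
    refine integral_mono (((h.mo_cd j).good t).2.abs.const_mul _)
      (((h.cd_rho.good t).2.const_mul _).add ((h.gg_cd.good t).2.const_mul _)) fun x => ?_
    have r0 := rho_nonneg (A := A) (B := B) (t, x)
    have g0 := gg0 (t, x)
    have := pt (t, x)
    simp only [sl]
    refine abs_le_of_sq_le_sq' (a := 2 * |mo A B j (t, x)|) ?_ (by positivity) |>.2
    rw [mul_pow, sq_abs]
    have hss : s * s⁻¹ = 1 := mul_inv_cancel₀ hs.ne'
    have : (s * rho A B (t, x) + s⁻¹ * gg A B (t, x)) ^ 2 = (s * rho A B (t, x) - s⁻¹ * gg A B (t, x)) ^ 2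
      + 4 * (s * s⁻¹) * (rho A B (t, x) * gg A B (t, x)) := by ring
    rw [this, hss]
    nlinarith [sq_nonneg (s * rho A B (t, x) - s⁻¹ * gg A B (t, x))]
  set I := ∫ x, |sl (mo A B j) t x|
  have hlim : ∀ δ : ℝ, 0 < δ → I ≤ (Real.sqrt m + δ) * (Real.sqrt g + δ) := by
    intro δ hδ
    have a0 := Real.sqrt_nonneg m
    have b0 := Real.sqrt_nonneg g
    have ha : m ≤ (Real.sqrt m + δ) ^ 2 := by nlinarith [Real.sq_sqrt m0]
    have hb : g ≤ (Real.sqrt g + δ) ^ 2 := by nlinarith [Real.sq_sqrt g0]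
    generalize hα : Real.sqrt m + δ = α at *
    generalize hβ : Real.sqrt g + δ = β at *
    have α0 : 0 < α := by linarith
    have β0 : 0 < β := by linarith
    have k := key (β / α) (by positivity)
    have : β / α * m + (β / α)⁻¹ * g ≤ β / α * α ^ 2 + (β / α)⁻¹ * β ^ 2 := by gcongr
    have e : β / α * α ^ 2 + (β / α)⁻¹ * β ^ 2 = 2 * (α * β) := by field_simp; ring
    linarith
  have ht : Filter.Tendsto (fun δ : ℝ => (Real.sqrt m + δ) * (Real.sqrt g + δ)) (nhdsWithin 0 (Set.Ioi 0))
      (nhds ((Real.sqrt m + 0) * (Real.sqrt g + 0))) :=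
    (Continuous.tendsto (by fun_prop) 0).mono_left nhdsWithin_le_nhds
  simp only [add_zero] at ht
  exact ge_of_tendsto ht (Filter.eventually_of_mem self_mem_nhdsWithin fun δ hδ => hlim δ hδ)

theorem Mor_bd (h : Sys p lam A B) {ε : ℝ} (hε : 0 < ε) (t : ℝ) :
    |Mor ε A B t| ≤ 3 * (Real.sqrt (∫ x, sl (rho A B) 0 x) ^ 3
      * ⨆ t, Real.sqrt (∫ x, sl (gg A B) t x)) := by
  set m := ∫ x, sl (rho A B) 0 x with hm
  have m0 : 0 ≤ m := integral_nonneg fun x => rho_nonneg _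
  have hsup := le_ciSup h.bdd t
  have b : ∀ j, |form (ka ε j) (sl (rho A B) t) (sl (mo A B j) t)| ≤
      Real.sqrt m ^ 3 * ⨆ t, Real.sqrt (∫ x, sl (gg A B) t x) := by
    intro j
    have b1 := form_abs_le (BK_ka hε j).1 (C := 1) (fun z => coord_kb_le hε j z) (h.cd_rho.good t)
      ((h.mo_cd j).good t)
    have b2 := h.mo_le t j
    have e : ∫ x, |sl (rho A B) t x| = m := by
      rw [hm, ← h.mass t]; congr 1; ext x; exact abs_of_nonneg (rho_nonneg _)
    rw [e, one_mul] at b1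
    rw [h.mass t, ← hm] at b2
    have : m = Real.sqrt m ^ 2 := (Real.sq_sqrt m0).symm
    calc _ ≤ _ := b1
      _ ≤ m * (Real.sqrt m * ⨆ t, Real.sqrt (∫ x, sl (gg A B) t x)) := by
          gcongr
          exact b2.trans (mul_le_mul_of_nonneg_left hsup (Real.sqrt_nonneg _))
      _ = Real.sqrt m ^ 2 * (Real.sqrt m * ⨆ t, Real.sqrt (∫ x, sl (gg A B) t x)) := by rw [← this]
      _ = _ := by ring
  unfold Mor
  calc _ ≤ ∑ j, |form (ka ε j) (sl (rho A B) t) (sl (mo A B j) t)| := Finset.abs_sum_le_sum_abs _ _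
    _ ≤ ∑ j : Fin 3, Real.sqrt m ^ 3 * ⨆ t, Real.sqrt (∫ x, sl (gg A B) t x) :=
        Finset.sum_le_sum fun j _ => b j
    _ = _ := by simp

theorem k7_cont (h : Sys p lam A B) {ε : ℝ} (hε : 0 < ε) :
    Continuous fun t => form (fun z => kb ε z ^ 7) (sl (rho A B) t) (sl (rho A B) t) :=
  continuous_iff_continuousAt.2 fun t => (leib2 ((BK_kb hε).pow 7) h.cd_rho h.rhoT_cd h.rho_t
    h.cd_rho h.rhoT_cd h.rho_t t).continuousAt

theorem int_k7 (h : Sys p lam A B) {ε T : ℝ} (hε : 0 < ε) (hT : 0 ≤ T) :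
    ∫ t in (-T)..T, 15 / 2 * ε ^ 4 * form (fun z => kb ε z ^ 7) (sl (rho A B) t) (sl (rho A B) t)
      ≤ 6 * (Real.sqrt (∫ x, sl (rho A B) 0 x) ^ 3
      * ⨆ t, Real.sqrt (∫ x, sl (gg A B) t x)) := by
  have a := intervalIntegral.integral_le_sub_of_hasDeriv_right_of_le (a := -T) (b := T)
    (g := Mor ε A B) (g' := MorD ε p lam A B)
    (φ := fun t => 15 / 2 * ε ^ 4 * form (fun z => kb ε z ^ 7) (sl (rho A B) t) (sl (rho A B) t))
    (by linarith)
    (fun t _ => (h.Mor_deriv hε t).continuousAt.continuousWithinAt)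
    (fun t _ => (h.Mor_deriv hε t).hasDerivWithinAt)
    ((continuous_const.mul (h.k7_cont hε)).continuousOn.integrableOn_Icc)
    (fun t _ => h.MorD_lower hε t)
  have b1 := abs_le.1 (h.Mor_bd hε T)
  have b2 := abs_le.1 (h.Mor_bd hε (-T))
  linarith [b1.2, b2.1]

end Sys


theorem Nice.lip {F : Q3 → ℝ} (h : Nice F) (T : ℝ) :
    ∃ C : ℝ, 0 ≤ C ∧ ∀ t, |t| ≤ T → ∀ x y, |F (t, x) - F (t, y)| ≤ C * ‖x - y‖ := by
  obtain ⟨C, c0, hC⟩ := h.2 1 T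
  refine ⟨C, c0, fun t ht x y => ?_⟩
  have := Convex.norm_image_sub_le_of_norm_fderiv_le (𝕜 := ℝ) (f := sl F t) (C := C) (s := Set.univ)
    (x := y) (y := x)
    (fun z _ => ((sl_smooth h.1 t).differentiable (by simp)) z)
    (fun z _ => by
      have := hC t ht z
      rw [norm_iteratedFDeriv_one] at this
      exact this.trans (by nlinarith [Wt_le z])) convex_univ (Set.mem_univ _) (Set.mem_univ _)
  simpa [sl] using this

def kap : ℝ := (volume : Measure E3).real (Metric.ball 0 1)

theorem kap_pos : 0 < kap := by
  unfold kap
  exact ENNReal.toReal_pos (Metric.measure_ball_pos _ _ one_pos).ne' measure_ball_lt_top.ne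

theorem ball_vol (x : E3) {ε : ℝ} (hε : 0 < ε) :
    (volume : Measure E3).real (Metric.ball x ε) = ε ^ 3 * kap := by
  unfold kap Measure.real
  rw [Measure.addHaar_ball _ _ hε.le]
  simp [ENNReal.toReal_mul, ENNReal.toReal_ofReal (pow_nonneg hε.le 3)]

theorem kb_lower {ε : ℝ} (hε : 0 < ε) {z : E3} (hz : ‖z‖ < ε) : (2 * ε)⁻¹ ≤ kb ε z := by
  unfold kb
  apply inv_anti₀ (by positivity)
  rw [Real.sqrt_le_left (by positivity)]
  nlinarith [norm_nonneg z]

namespace Sys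
variable {p lam : ℝ} {A B : Q3 → ℝ}

theorem rho_lip (h : Sys p lam A B) (T : ℝ) :
    ∃ L : ℝ, 0 ≤ L ∧ ∀ t, |t| ≤ T → ∀ x y, |rho A B (t, x) - rho A B (t, y)| ≤ L * ‖x - y‖ := by
  obtain ⟨a, a0, ha⟩ := h.nA.lip T
  obtain ⟨b, b0, hb⟩ := h.nB.lip T
  obtain ⟨c, c0, hc⟩ := h.nA.cd.2.lb T
  obtain ⟨d, d0, hd⟩ := h.nB.cd.2.lb T
  refine ⟨a * (2 * c) + b * (2 * d), by positivity, fun t ht x y => ?_⟩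
  have e : rho A B (t, x) - rho A B (t, y) = (A (t, x) - A (t, y)) * (A (t, x) + A (t, y))
    + (B (t, x) - B (t, y)) * (B (t, x) + B (t, y)) := by unfold rho; ring
  rw [e]
  have s1 : |A (t, x) + A (t, y)| ≤ 2 * c :=
    (abs_add_le _ _).trans (by linarith [hc t ht x, hc t ht y])
  have s2 : |B (t, x) + B (t, y)| ≤ 2 * d :=
    (abs_add_le _ _).trans (by linarith [hd t ht x, hd t ht y])
  calc _ ≤ _ := abs_add_le _ _
    _ = |A (t, x) - A (t, y)| * |A (t, x) + A (t, y)| + |B (t, x) - B (t, y)| * |B (t, x) + B (t, y)| := by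
        rw [abs_mul, abs_mul]
    _ ≤ (a * ‖x - y‖) * (2 * c) + (b * ‖x - y‖) * (2 * d) :=
        add_le_add (mul_le_mul (ha t ht x y) s1 (abs_nonneg _) (by positivity))
          (mul_le_mul (hb t ht x y) s2 (abs_nonneg _) (by positivity))
    _ = _ := by ring

theorem inner_lower {ε L : ℝ} (hε : 0 < ε) {r : E3 → ℝ} (hr : Good r) (r0 : ∀ x, 0 ≤ r x)
    (hL : ∀ x y, |r x - r y| ≤ L * ‖x - y‖) (L0 : 0 ≤ L) (x : E3) :
    (ε ^ 3 * kap) * ((2 * ε)⁻¹ ^ 7 * (r x * r x - L * ε * r x))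
      ≤ ∫ y, r y * kb ε (x - y) ^ 7 * r x := by
  obtain ⟨kc, C, hC⟩ := (BK_kb hε).pow 7
  have kc' : Continuous fun y : E3 => kb ε (x - y) ^ 7 := kc.comp (continuous_const.sub continuous_id)
  have i : Integrable fun y => r y * kb ε (x - y) ^ 7 * r x := by
    refine Integrable.mul_const ?_ _
    refine (hr.2.bdd_mul (c := C) kc'.aestronglyMeasurable
      (Filter.Eventually.of_forall fun y => hC _)).congr (Filter.Eventually.of_forall fun y => ?_)
    simp only; ring
  have nn : ∀ y, 0 ≤ r y * kb ε (x - y) ^ 7 * r x := fun y =>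
    mul_nonneg (mul_nonneg (r0 y) (pow_nonneg (kb_pos hε _).le _)) (r0 x)
  refine le_trans ?_ (setIntegral_le_integral (s := Metric.ball x ε) i (Filter.Eventually.of_forall nn))
  have e : (ε ^ 3 * kap) * ((2 * ε)⁻¹ ^ 7 * (r x * r x - L * ε * r x))
    = ∫ y in Metric.ball x ε, (2 * ε)⁻¹ ^ 7 * (r x * r x - L * ε * r x) := by
    rw [setIntegral_const, ball_vol x hε, smul_eq_mul]
  rw [e]
  refine setIntegral_mono_on ?_ i.integrableOn measurableSet_ball fun y hy => ?_
  · exact integrableOn_const measure_ball_lt_top.ne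
  have hz : ‖x - y‖ < ε := by rw [← dist_eq_norm, dist_comm]; exact hy
  have k := pow_le_pow_left₀ (by positivity) (kb_lower hε hz) 7
  have k0 : 0 ≤ (2 * ε)⁻¹ ^ 7 := by positivity
  have l1 : r x - L * ε ≤ r y := by
    have := (abs_le.1 (hL x y)).2
    nlinarith
  have rx := r0 x
  have ry := r0 y
  have : (2 * ε)⁻¹ ^ 7 * (r x * r x - L * ε * r x) ≤ (2 * ε)⁻¹ ^ 7 * (r y * r x) := by
    apply mul_le_mul_of_nonneg_left _ k0; nlinarith
  refine this.trans ?_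
  calc _ ≤ kb ε (x - y) ^ 7 * (r y * r x) := mul_le_mul_of_nonneg_right k (by positivity)
    _ = _ := by ring

theorem form_lower {ε L : ℝ} (hε : 0 < ε) {r : E3 → ℝ} (hr : Good r) (r0 : ∀ x, 0 ≤ r x)
    (hr2 : Integrable fun x => r x * r x)
    (hL : ∀ x y, |r x - r y| ≤ L * ‖x - y‖) (L0 : 0 ≤ L) :
    15 / 256 * kap * ((∫ x, r x * r x) - L * ε * ∫ x, r x)
      ≤ 15 / 2 * ε ^ 4 * form (fun z => kb ε z ^ 7) r r := by
  have i := form_int ((BK_kb hε).pow 7) hr hr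
  have e : form (fun z => kb ε z ^ 7) r r = ∫ x, ∫ y, r y * kb ε (x - y) ^ 7 * r x := by
    unfold form
    exact integral_prod _ i
  have i2 : Integrable fun x => ∫ y, r y * kb ε (x - y) ^ 7 * r x := i.integral_prod_left
  have i3 : Integrable fun x => (ε ^ 3 * kap) * ((2 * ε)⁻¹ ^ 7 * (r x * r x - L * ε * r x)) :=
    ((hr2.sub (hr.2.const_mul _)).const_mul _).const_mul _
  have m := integral_mono i3 i2 fun x => inner_lower hε hr r0 hL L0 x
  rw [integral_const_mul, integral_const_mul, integral_sub hr2 (hr.2.const_mul _),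
    integral_const_mul, ← e] at m
  have m2 := mul_le_mul_of_nonneg_left m (show 0 ≤ 15 / 2 * ε ^ 4 by positivity)
  refine le_trans (le_of_eq ?_) m2
  field_simp
  ring

theorem l4_int (h : Sys p lam A B) {T : ℝ} (hT : 0 ≤ T) :
    15 / 256 * kap * ∫ t in (-T)..T, ∫ x, sl (rho A B) t x * sl (rho A B) t x
      ≤ 6 * (Real.sqrt (∫ x, sl (rho A B) 0 x) ^ 3
      * ⨆ t, Real.sqrt (∫ x, sl (gg A B) t x)) := by
  obtain ⟨L, L0, hL⟩ := h.rho_lip T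
  set X := Real.sqrt (∫ x, sl (rho A B) 0 x) ^ 3 * ⨆ t, Real.sqrt (∫ x, sl (gg A B) t x)
  set m := ∫ x, sl (rho A B) 0 x with hm
  have cont : Continuous fun t => ∫ x, sl (rho A B) t x * sl (rho A B) t x :=
    continuous_iff_continuousAt.2 fun t => (leib1 (h.cd_rho.mul h.cd_rho)
      ((h.rhoT_cd.mul h.cd_rho).add (h.cd_rho.mul h.rhoT_cd)) (h.rho_t.mul h.rho_t) t).continuousAt
  have key : ∀ ε : ℝ, 0 < ε → 15 / 256 * kap * ((∫ t in (-T)..T, ∫ x, sl (rho A B) t x * sl (rho A B) t x)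
      - 2 * T * (L * ε * m)) ≤ 6 * X := by
    intro ε hε
    refine le_trans ?_ (h.int_k7 hε hT)
    have e : 15 / 256 * kap * ((∫ t in (-T)..T, ∫ x, sl (rho A B) t x * sl (rho A B) t x)
      - 2 * T * (L * ε * m)) = ∫ t in (-T)..T, 15 / 256 * kap *
        ((∫ x, sl (rho A B) t x * sl (rho A B) t x) - L * ε * m) := by
      rw [intervalIntegral.integral_const_mul, intervalIntegral.integral_sub
        (cont.intervalIntegrable _ _) intervalIntegrable_const, intervalIntegral.integral_const,
        smul_eq_mul]
      ring
    rw [e]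
    refine intervalIntegral.integral_mono_on (by linarith)
      (Continuous.intervalIntegrable (by fun_prop) _ _)
      ((continuous_const.mul (h.k7_cont hε)).intervalIntegrable _ _) fun t ht => ?_
    have := form_lower hε (h.cd_rho.good t) (fun _ => rho_nonneg _)
      ((h.cd_rho.mul h.cd_rho).good t).2 (L := L)
      (fun x y => hL t (abs_le.2 ⟨ht.1, ht.2⟩) x y) L0
    rw [h.mass t] at this
    exact this
  have ht : Filter.Tendsto (fun ε : ℝ => 15 / 256 * kap *
      ((∫ t in (-T)..T, ∫ x, sl (rho A B) t x * sl (rho A B) t x) - 2 * T * (L * ε * m)))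
      (nhdsWithin 0 (Set.Ioi 0)) (nhds (15 / 256 * kap *
      ((∫ t in (-T)..T, ∫ x, sl (rho A B) t x * sl (rho A B) t x) - 2 * T * (L * 0 * m)))) :=
    (Continuous.tendsto (by fun_prop) 0).mono_left nhdsWithin_le_nhds
  simp only [mul_zero, zero_mul, sub_zero] at ht
  exact le_of_tendsto ht (Filter.eventually_of_mem self_mem_nhdsWithin fun ε hε => key ε hε)

theorem l4 (h : Sys p lam A B) :
    ∫ t, ∫ x, sl (rho A B) t x * sl (rho A B) t x
      ≤ (512 / (5 * kap)) * (Real.sqrt (∫ x, sl (rho A B) 0 x) ^ 3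
      * ⨆ t, Real.sqrt (∫ x, sl (gg A B) t x)) := by
  have kp := kap_pos
  set X := Real.sqrt (∫ x, sl (rho A B) 0 x) ^ 3 * ⨆ t, Real.sqrt (∫ x, sl (gg A B) t x) with hX
  have X0 : 0 ≤ X := mul_nonneg (by positivity) (Real.iSup_nonneg fun t => Real.sqrt_nonneg _)
  have key : ∀ T : ℝ, 0 ≤ T → ∫ t in (-T)..T, ∫ x, sl (rho A B) t x * sl (rho A B) t x
      ≤ (512 / (5 * kap)) * X := by
    intro T hT
    have := h.l4_int hT
    rw [← hX] at this
    rw [div_mul_eq_mul_div, le_div_iff₀ (by positivity)]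
    linarith
  by_cases i : Integrable fun t => ∫ x, sl (rho A B) t x * sl (rho A B) t x
  · have := intervalIntegral_tendsto_integral i Filter.tendsto_neg_atTop_atBot Filter.tendsto_id
    exact le_of_tendsto this ((Filter.eventually_ge_atTop 0).mono fun T hT => key T hT)
  · rw [integral_undef i]; positivity

end Sys


/-- composition of the solution with a real-linear functional -/
def lcomp (l : ℂ →L[ℝ] ℝ) (u : ℝ → En 3 → ℂ) (q : Q3) : ℝ := l (u q.1 q.2)

theorem w8 (s : ℝ) (hs : 0 ≤ s) : (1 + s) ^ 4 ≤ 8 * (1 + s ^ 4) := by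
  nlinarith [sq_nonneg (s - 1), sq_nonneg (s ^ 2 - 1), mul_nonneg hs (sq_nonneg (s - 1)),
    mul_nonneg hs hs, sq_nonneg (s ^ 2 - s), pow_nonneg hs 3]

theorem lcomp_nice {p lam : ℝ} {u : ℝ → En 3 → ℂ} (h : NLSSolution 3 p lam u) (l : ℂ →L[ℝ] ℝ) :
    Nice (lcomp l u) := by
  refine ⟨l.contDiff.comp h.smooth, fun k T => ?_⟩
  obtain ⟨C0, h0⟩ := h.decay k 0 T
  obtain ⟨C4, h4⟩ := h.decay k 4 T
  refine ⟨‖l‖ * (8 * (|C0| + |C4|)), by positivity, fun t ht x => ?_⟩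
  have us : ContDiff ℝ (⊤ : ℕ∞) (u t) := h.smooth.comp (contDiff_const.prodMk contDiff_id)
  have e : sl (lcomp l u) t = l ∘ u t := rfl
  rw [e]
  have b := l.norm_iteratedFDeriv_comp_left (f := u t) (x := x) us.contDiffAt (n := k)
    (by exact_mod_cast (le_top : (k : ℕ∞) ≤ ⊤))
  refine b.trans ?_
  rw [mul_assoc]
  refine mul_le_mul_of_nonneg_left ?_ (norm_nonneg _)
  have a0 := h0 t ht x
  have a4 := h4 t ht x
  set N := ‖iteratedFDeriv ℝ k (u t) x‖ with hN
  have N0 : 0 ≤ N := norm_nonneg _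
  have ew : Wt x = ((1 + ‖x‖) ^ 4)⁻¹ := by
    unfold Wt; rw [Real.rpow_neg (by positivity)]; norm_cast
  rw [ew, ← div_eq_mul_inv, le_div_iff₀ (by positivity)]
  have := w8 ‖x‖ (norm_nonneg x)
  simp only [pow_zero, one_mul] at a0
  have c0 := le_abs_self C0
  have c4 := le_abs_self C4
  nlinarith [mul_le_mul_of_nonneg_left this N0]

theorem lcomp_d1 {u : ℝ → En 3 → ℂ}
    (h : ContDiff ℝ (⊤ : ℕ∞) (fun q : ℝ × En 3 => u q.1 q.2)) (l : ℂ →L[ℝ] ℝ) (j : Fin 3) :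
    d1 j (lcomp l u) = lcomp l (fun t => pd j (u t)) := by
  have hs : ContDiff ℝ (⊤ : ℕ∞) (lcomp l u) := l.contDiff.comp h
  ext ⟨t, x⟩
  have e := sl_dd hs t j x
  have us : ContDiff ℝ (⊤ : ℕ∞) (u t) := h.comp (contDiff_const.prodMk contDiff_id)
  have ud : DifferentiableAt ℝ (u t) x := us.differentiable (by simp) x
  change sl (dd (ex j) (lcomp l u)) t x = _
  rw [e]
  have : sl (lcomp l u) t = l ∘ u t := rfl
  rw [this, (l.hasFDerivAt.comp x ud.hasFDerivAt).fderiv]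
  rfl

theorem pd_smooth {u : ℝ → En 3 → ℂ}
    (h : ContDiff ℝ (⊤ : ℕ∞) (fun q : ℝ × En 3 => u q.1 q.2)) (j : Fin 3) :
    ContDiff ℝ (⊤ : ℕ∞) (fun q : ℝ × En 3 => pd j (u q.1) q.2) := by
  have e : (fun q : ℝ × En 3 => pd j (u q.1) q.2)
      = fun q => fderiv ℝ (fun q : ℝ × En 3 => u q.1 q.2) q (ex j) := by
    ext ⟨t, x⟩
    have hd := (h.differentiable (by simp) (t, x)).hasFDerivAt
    have hc : HasFDerivAt (fun y : En 3 => ((t, y) : ℝ × En 3)) (ContinuousLinearMap.inr ℝ ℝ (En 3)) x :=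
      hasFDerivAt_prodMk_right t x
    have := (hd.comp x hc).fderiv
    change fderiv ℝ (u t) x _ = _
    have e2 : ((fun q : ℝ × En 3 => u q.1 q.2) ∘ fun y : En 3 => ((t, y) : ℝ × En 3)) = u t := rfl
    rw [e2] at this
    rw [this]
    rfl
  rw [e]
  exact (h.fderiv_right (m := (⊤ : ℕ∞)) (by norm_cast)).clm_apply contDiff_const

theorem lcomp_lap {u : ℝ → En 3 → ℂ}
    (h : ContDiff ℝ (⊤ : ℕ∞) (fun q : ℝ × En 3 => u q.1 q.2)) (l : ℂ →L[ℝ] ℝ) (q : Q3) :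
    Lap (lcomp l u) q = l (lap (u q.1) q.2) := by
  unfold Lap lap
  rw [map_sum]
  refine Finset.sum_congr rfl fun k _ => ?_
  rw [lcomp_d1 h l k, lcomp_d1 (u := fun t => pd k (u t)) (pd_smooth h k) l k]
  rfl

theorem lcomp_t {u : ℝ → En 3 → ℂ}
    (h : ContDiff ℝ (⊤ : ℕ∞) (fun q : ℝ × En 3 => u q.1 q.2)) (l : ℂ →L[ℝ] ℝ) (q : Q3) :
    dd et (lcomp l u) q = l (deriv (fun s => u s q.2) q.1) := by
  have hs : ContDiff ℝ (⊤ : ℕ∞) (lcomp l u) := l.contDiff.comp h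
  have h1 := (HL_dd hs et).time q.1 q.2
  have us : ContDiff ℝ (⊤ : ℕ∞) (fun s => u s q.2) := h.comp (contDiff_id.prodMk contDiff_const)
  have h2 := l.hasFDerivAt.comp_hasDerivAt q.1 (us.differentiable (by simp) q.1).hasDerivAt
  exact h1.unique h2

theorem mkSys {p lam : ℝ} (hp : 1 < p) (hl : 0 < lam) {u : ℝ → En 3 → ℂ}
    (h : NLSSolution 3 p lam u) : Sys p lam (lcomp reCLM u) (lcomp imCLM u) := by
  have hr : ∀ q : Q3, ‖u q.1 q.2‖ ^ (p - 1) = rho (lcomp reCLM u) (lcomp imCLM u) q ^ ((p - 1) / 2) := by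
    intro q
    have : rho (lcomp reCLM u) (lcomp imCLM u) q = ‖u q.1 q.2‖ ^ 2 := by
      rw [← Complex.normSq_eq_norm_sq, Complex.normSq_apply]
      simp only [rho, lcomp, reCLM_apply, imCLM_apply]; ring
    rw [this, ← Real.rpow_natCast, ← Real.rpow_mul (norm_nonneg _)]
    congr 1; push_cast; ring
  refine ⟨hp, hl, lcomp_nice h _, lcomp_nice h _, fun q => ?_, fun q => ?_⟩
  · have e := congrArg Complex.im (h.eq q.1 q.2)
    have e' := congrArg Complex.re (h.eq q.1 q.2)
    rw [lcomp_t h.smooth, lcomp_lap h.smooth]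
    rw [hr q] at e
    simp at e
    simp only [ff, lcomp, reCLM_apply, imCLM_apply] at *
    linarith
  · have e := congrArg Complex.re (h.eq q.1 q.2)
    rw [lcomp_t h.smooth, lcomp_lap h.smooth]
    rw [hr q] at e
    simp at e
    simp only [ff, lcomp, reCLM_apply, imCLM_apply] at *
    linarith

/-- `L⁴` spacetime bound in three dimensions. -/
theorem statement_11 :
    ∃ C : ℝ, 0 < C ∧
      ∀ (p lam : ℝ), 1 < p → 0 < lam →
        ∀ u : ℝ → En 3 → ℂ, NLSSolution 3 p lam u →
          (∫ t : ℝ, ∫ x : En 3, ‖u t x‖ ^ 4)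
            ≤ C * (Real.sqrt (∫ x : En 3, ‖u 0 x‖ ^ 2)) ^ 3
                * (⨆ t : ℝ, Real.sqrt (∫ x : En 3, ∑ j, ‖pd j (u t) x‖ ^ 2)) := by

  have kp := kap_pos
  refine ⟨512 / (5 * kap), by positivity, fun p lam hp hl u h => ?_⟩
  have S := mkSys hp hl h
  have key := S.l4
  have hz : ∀ z : ℂ, z.re ^ 2 + z.im ^ 2 = ‖z‖ ^ 2 := fun z => by
    rw [← Complex.normSq_eq_norm_sq, Complex.normSq_apply]; ring
  have er : ∀ t x, sl (rho (lcomp reCLM u) (lcomp imCLM u)) t x = ‖u t x‖ ^ 2 := fun t x => hz _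
  have eg : ∀ t x, sl (Sys.gg (lcomp reCLM u) (lcomp imCLM u)) t x = ∑ j, ‖pd j (u t) x‖ ^ 2 := by
    intro t x
    unfold sl Sys.gg
    refine Finset.sum_congr rfl fun j _ => ?_
    rw [lcomp_d1 h.smooth, lcomp_d1 h.smooth]
    exact hz _
  have e4 : ∀ t x, ‖u t x‖ ^ 2 * ‖u t x‖ ^ 2 = ‖u t x‖ ^ 4 := fun t x => by ring
  simp only [er, eg, e4] at key
  rw [mul_assoc]
  exact key
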